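/- arXiv:1609.06025 — 2 statements merged into one kernel-verified Lean document; each statement's English description precedes it below -/
import Mathlib

section
/- Assume Schanuel's conjecture over the reals. Let P ∈ 𝕂[X₁,…,Xₙ,U₁,…,Uₙ] be such that Z(P) ⊆ ℝ^{2n} is an irreducible real algebraic set over 𝕂, let f = E(P), and assume dim Z(f) = n−1. Then either Z(f) is irreducible as an exponential set over 𝕂, or every irreducible component T of Z(f) with dim T = n−1 is a rational hyperplane through the origin, i.e., T = {x ∈ ℝⁿ : m₁x₁+⋯+mₙxₙ = 0} for some integers m₁,…,mₙ not all zero. -/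
open MeasureTheory Set
open scoped ENNReal

noncomputable section

/-- `K` is a real algebraic extension of `ℚ`: every element of `K` is algebraic over `ℚ`. -/
def RealAlgExt (K : Subfield ℝ) : Prop := ∀ a : K, IsAlgebraic ℚ (a : ℝ)

/-- A real polynomial has all its coefficients in the subfield `K` of `ℝ`. -/
def CoeffsIn {σ : Type*} (K : Subfield ℝ) (P : MvPolynomial σ ℝ) : Prop :=
  ∀ m, P.coeff m ∈ K

/-- Evaluation of a polynomial in `X₁,…,Xₙ,U₁,…,Uₙ` at `(x, e^x)`:
the E-polynomial associated to `P`. -/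
def expEval {n : ℕ} (P : MvPolynomial (Fin n ⊕ Fin n) ℝ) (x : Fin n → ℝ) : ℝ :=
  MvPolynomial.eval (Sum.elim x fun i => Real.exp (x i)) P

/-- Exponential sets over `K` in `ℝⁿ`: zero sets of E-polynomials over `K`. -/
def IsExpSet {n : ℕ} (K : Subfield ℝ) (V : Set (Fin n → ℝ)) : Prop :=
  ∃ P : MvPolynomial (Fin n ⊕ Fin n) ℝ, CoeffsIn K P ∧ V = {x | expEval P x = 0}

/-- Real algebraic sets over `K` (in coordinates indexed by `σ`). -/
def IsAlgSet {σ : Type*} (K : Subfield ℝ) (S : Set (σ → ℝ)) : Prop :=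
  ∃ P : MvPolynomial σ ℝ, CoeffsIn K P ∧ S = {x | MvPolynomial.eval x P = 0}

/-- An exponential set is irreducible if it is nonempty and is not the union of
two proper exponential subsets. -/
def IsIrredExpSet {n : ℕ} (K : Subfield ℝ) (V : Set (Fin n → ℝ)) : Prop :=
  IsExpSet K V ∧ V.Nonempty ∧
    ¬ ∃ V₁ V₂ : Set (Fin n → ℝ),
      IsExpSet K V₁ ∧ IsExpSet K V₂ ∧ V = V₁ ∪ V₂ ∧ V₁ ⊂ V ∧ V₂ ⊂ V

/-- `T` is an irreducible component of `V`: a maximal irreducible exponential subset of `V`. -/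
def IsExpComponent {n : ℕ} (K : Subfield ℝ) (T V : Set (Fin n → ℝ)) : Prop :=
  IsIrredExpSet K T ∧ T ⊆ V ∧
    ∀ T', IsIrredExpSet K T' → T ⊆ T' → T' ⊆ V → T' = T

/-- A real algebraic set is irreducible over `K` if it is nonempty and is not the union of
two proper algebraic subsets over `K`. -/
def IsIrredAlgSet {σ : Type*} (K : Subfield ℝ) (V : Set (σ → ℝ)) : Prop :=
  IsAlgSet K V ∧ V.Nonempty ∧
    ¬ ∃ V₁ V₂ : Set (σ → ℝ),
      IsAlgSet K V₁ ∧ IsAlgSet K V₂ ∧ V = V₁ ∪ V₂ ∧ V₁ ⊂ V ∧ V₂ ⊂ V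

/-- `T` is an irreducible component over `K` of the real algebraic set `V`. -/
def IsAlgComponent {σ : Type*} (K : Subfield ℝ) (T V : Set (σ → ℝ)) : Prop :=
  IsIrredAlgSet K T ∧ T ⊆ V ∧
    ∀ T', IsIrredAlgSet K T' → T ⊆ T' → T' ⊆ V → T' = T

/-- Local (Hausdorff) dimension of `A` at `x`. -/
def locDim {n : ℕ} (A : Set (Fin n → ℝ)) (x : Fin n → ℝ) : ℝ≥0∞ :=
  ⨅ (ε : ℝ) (_ : 0 < ε), dimH (A ∩ Metric.ball x ε)

/-- `A_p`: the set of points of `A` at which `A` has local dimension `p`. -/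
def localSet {n : ℕ} (A : Set (Fin n → ℝ)) (p : ℕ) : Set (Fin n → ℝ) :=
  {x | x ∈ A ∧ locDim A x = (p : ℝ≥0∞)}

/-- The exponent vectors of the `U`-monomials of `P` (with nonzero coefficient in `𝕂[X]`). -/
def Uexps {n : ℕ} (P : MvPolynomial (Fin n ⊕ Fin n) ℝ) : Set (Fin n → ℕ) :=
  (fun (m : (Fin n ⊕ Fin n) →₀ ℕ) (i : Fin n) => m (Sum.inr i)) '' (P.support : Set _)

/-- The union `W_P` of the linear hyperplane sets associated to pairs of distinct
`U`-monomials of `P`. -/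
def WP {n : ℕ} (P : MvPolynomial (Fin n ⊕ Fin n) ℝ) : Set (Fin n → ℝ) :=
  {x | ∃ d e : Fin n → ℕ, d ∈ Uexps P ∧ e ∈ Uexps P ∧ d ≠ e ∧
    ∑ i, (d i : ℝ) * x i = ∑ i, (e i : ℝ) * x i}

/-- Schanuel's conjecture over the reals, with "the transcendence degree of
`ℚ(x₁,…,xₙ,e^{x₁},…,e^{xₙ})` over `ℚ` is less than `n`" expressed as: no `n`-tuple of
elements of `{x₁,…,xₙ,e^{x₁},…,e^{xₙ}}` is algebraically independent over `ℚ`. -/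
def SchanuelConjecture : Prop :=
  ∀ (n : ℕ) (x : Fin n → ℝ),
    (¬ ∃ v : Fin n → ℝ,
        (∀ i, v i ∈ Set.range x ∪ Set.range fun j => Real.exp (x j)) ∧
        AlgebraicIndependent ℚ v) →
    ∃ m : Fin n → ℤ, (∃ i, m i ≠ 0) ∧ ∑ i, (m i : ℝ) * x i = 0

theorem AlgebraicIndependent.option_elim_of_mem_sdiff {K A ι : Type*} [Field K] [CommRing A]
    [Algebra K A] {I J : Ideal A} [hI : I.IsPrime] (hIJ : I ≤ J) {F : A} (hFJ : F ∈ J)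
    (hFI : F ∉ I) {y : ι → A}
    (hy : AlgebraicIndependent K fun i => Ideal.Quotient.mkₐ K J (y i)) :
    AlgebraicIndependent K fun o : Option ι =>
      Ideal.Quotient.mkₐ K I (o.elim F y) := by
  set π : A ⧸ I →ₐ[K] A ⧸ J := Ideal.Quotient.factorₐ K hIJ with hπ
  set yI : ι → A ⧸ I := fun i => Ideal.Quotient.mkₐ K I (y i) with hyI_def
  have hcomp : π ∘ yI = fun i => Ideal.Quotient.mkₐ K J (y i) := rfl
  have hyI : AlgebraicIndependent K yI := AlgebraicIndependent.of_comp π (hcomp ▸ hy)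
  have hF0 : Ideal.Quotient.mkₐ K I F ≠ 0 := by
    simpa [Ideal.Quotient.eq_zero_iff_mem] using hFI
  have key := (hyI.option_iff_transcendental (Ideal.Quotient.mkₐ K I F)).2 ?_
  · convert key using 1
    ext o
    cases o <;> rfl
  intro halg
  obtain ⟨q, hq0, hq⟩ := halg.exists_nonzero_coeff_and_aeval_eq_zero
    (mem_nonZeroDivisors_of_ne_zero hF0)
  apply hq0
  obtain ⟨c, hc⟩ : ∃ c : MvPolynomial ι K, MvPolynomial.aeval yI c = (q.coeff 0 : A ⧸ I) := by
    exact (Algebra.adjoin_range_eq_range_aeval K yI).le (q.coeff 0).2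
  have h1 : π (q.coeff 0 : A ⧸ I) = 0 := by
    rw [Polynomial.aeval_eq_sum_range, Finset.sum_range_succ'] at hq
    have h2 : π (Ideal.Quotient.mk I F) = 0 := by
      change Ideal.Quotient.mk J F = 0
      simpa [Ideal.Quotient.eq_zero_iff_mem] using hFJ
    have := congrArg π hq
    simpa [Algebra.smul_def, h2] using this
  have h3 : MvPolynomial.aeval (fun i => Ideal.Quotient.mkₐ K J (y i)) c = 0 := by
    rw [← hcomp, ← h1, ← hc, MvPolynomial.comp_aeval_apply]; rfl
  have h4 : c = 0 := (injective_iff_map_eq_zero _).1 hy c h3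
  rw [h4, map_zero] at hc
  exact Subtype.ext hc.symm

/-- A chain `0 ⊊ I ⊊ J` of primes bounds the number of independent elements modulo `J`. -/
theorem not_algebraicIndependent_mk_of_lt {K σ ι : Type*} [Field K] [Finite σ] [Finite ι]
    {I J : Ideal (MvPolynomial σ K)} [I.IsPrime] [J.IsPrime] (hI : I ≠ ⊥) (hIJ : I < J)
    (hcard : Nat.card σ < Nat.card ι + 2) (y : ι → MvPolynomial σ K) :
    ¬ AlgebraicIndependent K fun i => Ideal.Quotient.mkₐ K J (y i) := by
  intro hy
  obtain ⟨F, hFJ, hFI⟩ := SetLike.exists_of_lt hIJ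
  obtain ⟨G, hGI, hG0⟩ := Submodule.exists_mem_ne_zero_of_ne_bot hI
  have h1 := hy.option_elim_of_mem_sdiff hIJ.le hFJ hFI
  have h2 := h1.option_elim_of_mem_sdiff (I := ⊥) bot_le hGI (by simpa using hG0)
  have h3 := AlgebraicIndependent.of_comp (Ideal.Quotient.mkₐ K (⊥ : Ideal (MvPolynomial σ K)))
    (x := fun o : Option (Option ι) => o.elim G fun o => o.elim F y) h2
  have := h3.lift_cardinalMk_le_trdeg
  rw [MvPolynomial.trdeg_of_isDomain] at this
  have := Cardinal.toNat_le_toNat this (by simp)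
  simp only [Cardinal.toNat_lift] at this
  change Nat.card _ ≤ Nat.card _ at this
  simp only [Finite.card_option] at this
  omega

theorem not_algebraicIndependent_mk_of_lt_of_lt {K σ ι : Type*} [Field K] [Finite σ] [Finite ι]
    {I J L : Ideal (MvPolynomial σ K)} [I.IsPrime] [J.IsPrime] (hI : I ≠ ⊥) (hIJ : I < J)
    (hJL : J < L) (hcard : Nat.card σ < Nat.card ι + 3) (y : ι → MvPolynomial σ K) :
    ¬ AlgebraicIndependent K fun i => Ideal.Quotient.mkₐ K L (y i) := by
  intro hy
  obtain ⟨F, hFL, hFJ⟩ := SetLike.exists_of_lt hJL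
  refine not_algebraicIndependent_mk_of_lt hI hIJ (ι := Option ι) ?_ _
    (hy.option_elim_of_mem_sdiff hJL.le hFL hFJ)
  simp only [Finite.card_option]; omega

open Real in
/-- The Lindemann–Weierstrass statement, deduced from Schanuel's conjecture. -/
theorem SchanuelConjecture.algebraicIndependent_exp (hSch : SchanuelConjecture) {k : ℕ}
    {x : Fin k → ℝ} (hx : ∀ i, IsAlgebraic ℚ (x i)) (hlin : LinearIndependent ℚ x) :
    AlgebraicIndependent ℚ fun i => exp (x i) := by
  by_cases h : ∃ v : Fin k → ℝ, (∀ i, v i ∈ range x ∪ range fun j => exp (x j)) ∧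
      AlgebraicIndependent ℚ v
  · obtain ⟨v, hv, hind⟩ := h
    have h1 : ∀ i, ∃ j, exp (x j) = v i := by
      intro i
      rcases hv i with ⟨j, hj⟩ | hj
      · exact absurd (hj ▸ hx j) (hind.transcendental i)
      · exact hj
    choose g hg using h1
    have hinj : Function.Injective g := fun a b hab => hind.injective (by rw [← hg, ← hg, hab])
    let e := Equiv.ofBijective g (Finite.injective_iff_bijective.1 hinj)
    have h2 : (fun i => exp (x i)) = v ∘ e.symm := by
      ext i
      rw [Function.comp_apply, ← hg]
      exact congrArg _ (congrArg _ (e.apply_symm_apply i).symm)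
    rw [h2]
    exact hind.comp _ e.symm.injective
  · obtain ⟨m, ⟨i, hi⟩, hm⟩ := hSch k x h
    refine absurd ?_ hi
    have := Fintype.linearIndependent_iff.1 hlin (fun i => (m i : ℚ))
      (by simpa [Rat.smul_def] using hm) i
    exact_mod_cast this

open Real in
/-- Under Schanuel's conjecture, if `t` and `exp t` are algebraic over the field generated by
the exponentials of linearly independent algebraic numbers, then `t` is a rational
combination of these numbers. -/
theorem SchanuelConjecture.exists_eq_sum (hSch : SchanuelConjecture) {k : ℕ}
    {x : Fin k → ℝ} (hx : ∀ i, IsAlgebraic ℚ (x i)) (hlin : LinearIndependent ℚ x)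
    (L : IntermediateField ℚ ℝ) [Algebra.IsAlgebraic ℚ L] {t : ℝ}
    (ht : ¬ AlgebraicIndependent L fun o : Option (Fin k) => o.elim t fun i => exp (x i))
    (het : ¬ AlgebraicIndependent L fun o : Option (Fin k) => o.elim (exp t) fun i => exp (x i)) :
    ∃ q : Fin k → ℚ, t = ∑ i, (q i : ℝ) * x i := by
  have hind : AlgebraicIndependent L fun i => exp (x i) :=
    (hSch.algebraicIndependent_exp hx hlin).extendScalars L
  rw [hind.option_iff_transcendental, Transcendental, not_not] at ht het
  set X : Set ℝ := range fun i => exp (x i) with hX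
  let M := AlgebraicIndependent.matroid L ℝ
  have hcl : ∀ a : ℝ, IsAlgebraic (Algebra.adjoin L X) a → a ∈ M.closure X := by
    intro a ha
    rw [AlgebraicIndependent.matroid_closure_eq]
    exact ha
  by_cases h : ∃ v : Fin (k + 1) → ℝ, (∀ i, v i ∈ range (Fin.cons t x : Fin (k + 1) → ℝ) ∪
      range fun j => exp ((Fin.cons t x : Fin (k + 1) → ℝ) j)) ∧ AlgebraicIndependent ℚ v
  · exfalso
    obtain ⟨v, hv, hvi⟩ := h
    have hvL := hvi.extendScalars L
    have hsub : range v ⊆ M.closure X := by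
      rintro _ ⟨i, rfl⟩
      apply hcl
      rcases hv i with ⟨j, hj⟩ | ⟨j, hj⟩
      · rw [← hj]
        induction j using Fin.cases with
        | zero => simpa using ht
        | succ j =>
          rw [Fin.cons_succ]
          exact (hx j).extendScalars
            (algebraMap ℚ (Algebra.adjoin L X)).injective
      · rw [← hj]
        induction j using Fin.cases with
        | zero => simpa using het
        | succ j =>
          simp only [Fin.cons_succ]
          exact isAlgebraic_algebraMap (⟨_, Algebra.subset_adjoin ⟨j, rfl⟩⟩ : Algebra.adjoin L X)
    have hI : M.Indep (range v) := AlgebraicIndependent.matroid_indep_iff.2 hvL.to_subtype_range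
    have h1 := hI.encard_le_eRk_of_subset hsub
    rw [Matroid.eRk_closure_eq] at h1
    have h2 := h1.trans (M.eRk_le_encard X)
    rw [← image_univ, hvi.injective.encard_image, hX, ← image_univ] at h2
    have h3 := h2.trans (encard_image_le _ _)
    simp only [encard_univ, ENat.card_eq_coe_fintype_card, Fintype.card_fin] at h3
    have := ENat.natCast_le_natCast.1 h3
    omega
  · obtain ⟨m, ⟨i, hi⟩, hm⟩ := hSch _ _ h
    rw [Fin.sum_univ_succ] at hm
    simp only [Fin.cons_zero, Fin.cons_succ] at hm
    have hm0 : m 0 ≠ 0 := by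
      intro h0
      have h1 := Fintype.linearIndependent_iff.1 hlin (fun i => (m i.succ : ℚ))
        (by simpa [Rat.smul_def, h0] using hm)
      induction i using Fin.cases with
      | zero => exact hi h0
      | succ j => exact hi (by exact_mod_cast h1 j)
    have hm0' : (m 0 : ℝ) ≠ 0 := by exact_mod_cast hm0
    refine ⟨fun j => -(m j.succ : ℚ) / m 0, ?_⟩
    push_cast
    have : ∀ j, -(m (Fin.succ j) : ℝ) / m 0 * x j = -(1 / m 0) * (m j.succ * x j) := by
      intro j; ring
    simp_rw [this, ← Finset.mul_sum]
    field_simp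
    linarith

open Real in
/-- If a rational combination `t` of linearly independent algebraic numbers `xᵢ` satisfies an
algebraic relation between `exp t` and the `exp xᵢ`, then its coefficients are among finitely
many values determined by the monomials of the relation. -/
theorem SchanuelConjecture.exists_mem_support (hSch : SchanuelConjecture) {k : ℕ}
    {x : Fin k → ℝ} (hx : ∀ i, IsAlgebraic ℚ (x i)) (hlin : LinearIndependent ℚ x)
    (L : IntermediateField ℚ ℝ) [Algebra.IsAlgebraic ℚ L] (q : Fin k → ℚ)
    {B : MvPolynomial (Option (Fin k)) L} (hB : B ≠ 0)
    (hB0 : MvPolynomial.aeval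
      (fun o : Option (Fin k) => o.elim (exp (∑ i, (q i : ℝ) * x i)) fun i => exp (x i)) B = 0) :
    ∃ s ∈ B.support, ∃ s' ∈ B.support,
      q = fun i => ((s' (some i) : ℚ) - s (some i)) / (s none - s' none) := by
  set N : ℕ := ∏ i, (q i).den with hN
  have hNpos : N ≠ 0 := Finset.prod_ne_zero_iff.2 fun i _ => (q i).den_nz
  have hM : ∀ i, ∃ M : ℤ, (M : ℚ) = q i * N := by
    intro i
    obtain ⟨c, hc⟩ : (q i).den ∣ N := Finset.dvd_prod_of_mem _ (Finset.mem_univ i)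
    refine ⟨(q i).num * c, ?_⟩
    rw [hc]
    push_cast
    rw [← mul_assoc, Rat.mul_den_eq_num]
  choose M hM using hM
  set y : Fin k → ℝ := fun i => x i / N with hy
  have hNR : (N : ℝ) ≠ 0 := by exact_mod_cast hNpos
  have hxy : ∀ i, x i = N * y i := fun i => by simp only [hy]; field_simp
  have hyalg : ∀ i, IsAlgebraic ℚ (y i) := fun i =>
    (hx i).mul ((isAlgebraic_natCast N).inv)
  have hylin : LinearIndependent ℚ y := by
    have h := hlin.units_smul fun _ => (Units.mk0 (N : ℚ) (by exact_mod_cast hNpos))⁻¹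
    convert h using 1
    ext i
    simp [hy, Units.smul_def, Rat.smul_def, div_eq_inv_mul]
  have hind : AlgebraicIndependent L fun i => exp (y i) :=
    (hSch.algebraicIndependent_exp hyalg hylin).extendScalars L
  set J : ℕ := B.support.sup fun s => s none with hJ
  have hsJ : ∀ s ∈ B.support, s none ≤ J := fun s hs =>
    Finset.le_sup (f := fun s : Option (Fin k) →₀ ℕ => s none) hs
  set e : (Option (Fin k) →₀ ℕ) → Fin k →₀ ℕ := fun s => Finsupp.equivFunOnFinite.symm fun i =>
    N * s (some i) + (M i).toNat * s none + (-M i).toNat * (J - s none) with he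
  set R : MvPolynomial (Fin k) L :=
    ∑ s ∈ B.support, MvPolynomial.monomial (e s) (B.coeff s) with hR
  have heval : ∀ s ∈ B.support, ∀ i, ((e s i : ℕ) : ℝ) * y i =
      s (some i) * x i + s none * (q i * x i) + (-M i).toNat * J * y i := by
    intro s hs i
    have h1 : ((M i).toNat : ℝ) - ((-M i).toNat : ℝ) = q i * N := by
      have h2 : (((M i).toNat : ℤ) - ((-M i).toNat : ℤ)) = M i := Int.toNat_sub_toNat_neg _
      have h3 : ((M i : ℚ) : ℝ) = ((q i * N : ℚ) : ℝ) := by rw [hM]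
      rw [← h2] at h3
      push_cast at h3
      exact h3
    simp only [he, Finsupp.equivFunOnFinite_symm_apply_apply]
    rw [hxy i]
    push_cast [Nat.cast_sub (hsJ s hs)]
    linear_combination (s none : ℝ) * y i * h1
  have hR0 : R = 0 := by
    apply (injective_iff_map_eq_zero _).1 hind
    have hmul : MvPolynomial.aeval (fun i => exp (y i)) R =
        exp (∑ i, (-M i).toNat * J * y i) * MvPolynomial.aeval
      (fun o : Option (Fin k) => o.elim (exp (∑ i, (q i : ℝ) * x i)) fun i => exp (x i)) B := by
      rw [hR, map_sum, MvPolynomial.aeval_def, MvPolynomial.eval₂_eq', Finset.mul_sum]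
      refine Finset.sum_congr rfl fun s hs => ?_
      rw [MvPolynomial.aeval_monomial, Finsupp.prod_fintype _ _ (by simp), Fintype.prod_option]
      simp only [Option.elim_none, Option.elim_some, ← Real.exp_nat_mul, ← Real.exp_sum]
      rw [mul_left_comm, ← Real.exp_add, ← Real.exp_add, Finset.sum_congr rfl fun i _ =>
        heval s hs i, Finset.sum_add_distrib, Finset.sum_add_distrib, Finset.mul_sum]
      congr 2
      ring
    rw [hmul, hB0, mul_zero]
  obtain ⟨s₀, hs₀⟩ := MvPolynomial.support_nonempty.2 hB
  by_cases hex : ∃ s ∈ B.support, s ≠ s₀ ∧ e s = e s₀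
  · obtain ⟨s, hs, hne, hes⟩ := hex
    have hrel : ∀ i, (s (some i) : ℚ) + q i * s none = s₀ (some i) + q i * s₀ none := by
      intro i
      have h1 : (((-M i).toNat : ℕ) : ℚ) * J + N * (s (some i) + q i * s none) =
          ((-M i).toNat : ℕ) * J + N * (s₀ (some i) + q i * s₀ none) := by
        have h2 : (((M i).toNat : ℚ)) - ((-M i).toNat : ℚ) = q i * N := by
          rw [← hM]
          exact_mod_cast Int.toNat_sub_toNat_neg (M i)
        have h3 : ((e s i : ℕ) : ℚ) = e s₀ i := by rw [hes]
        simp only [he, Finsupp.equivFunOnFinite_symm_apply_apply] at h3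
        push_cast [Nat.cast_sub (hsJ s hs), Nat.cast_sub (hsJ s₀ hs₀)] at h3
        linear_combination h3 + (s₀ none - s none : ℚ) * h2
      exact mul_left_cancel₀ (by exact_mod_cast hNpos : (N : ℚ) ≠ 0) (add_left_cancel h1)
    have hnone : s none ≠ s₀ none := by
      intro h
      apply hne
      ext o
      cases o with
      | none => exact h
      | some i =>
        have := hrel i
        rw [h] at this
        exact_mod_cast add_right_cancel this
    refine ⟨s, hs, s₀, hs₀, ?_⟩
    ext i
    have : (s none : ℚ) - s₀ none ≠ 0 := sub_ne_zero.2 (by exact_mod_cast hnone)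
    rw [eq_div_iff this]
    linear_combination hrel i
  · push Not at hex
    exfalso
    have : R.coeff (e s₀) = B.coeff s₀ := by
      rw [hR, MvPolynomial.coeff_sum, Finset.sum_eq_single s₀]
      · simp
      · intro s hs hne
        rw [MvPolynomial.coeff_monomial, if_neg (hex s hs hne)]
      · simp
    rw [hR0, MvPolynomial.coeff_zero] at this
    exact (MvPolynomial.mem_support_iff.1 hs₀) this.symm

theorem exists_isAlgebraic_natDegree_ge (k : ℕ) :
    ∃ a : ℝ, IsAlgebraic ℚ a ∧ k ≤ (minpoly ℚ a).natDegree ∧ a ≠ 0 := by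
  obtain ⟨p, hkp, hp⟩ := Nat.exists_infinite_primes k
  have hirr : Irreducible (Polynomial.X ^ p - Polynomial.C (2 : ℚ)) := by
    apply X_pow_sub_C_irreducible_of_prime hp
    intro b hb
    have h2 : Fact (Nat.Prime 2) := ⟨Nat.prime_two⟩
    have h1 := congrArg (padicValRat 2) hb
    have hb0 : b ≠ 0 := by
      rintro rfl
      rw [zero_pow hp.ne_zero] at hb
      norm_num at hb
    rw [padicValRat.pow] at h1
    have h3 : padicValRat 2 2 = 1 := by
      simpa using padicValRat.self (p := 2) (by norm_num)
    rw [h3] at h1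
    have := Int.isUnit_iff.1 (IsUnit.of_mul_eq_one _ h1)
    have := hp.two_le
    omega
  have hpow : ((2 : ℝ) ^ ((1 : ℝ) / p)) ^ p = 2 := by
    rw [← Real.rpow_natCast, ← Real.rpow_mul (by norm_num)]
    have : (p : ℝ) ≠ 0 := by exact_mod_cast hp.ne_zero
    field_simp
    norm_num
  have hroot : Polynomial.aeval ((2 : ℝ) ^ ((1 : ℝ) / p))
      (Polynomial.X ^ p - Polynomial.C (2 : ℚ)) = 0 := by
    rw [map_sub, map_pow, Polynomial.aeval_X, Polynomial.aeval_C, hpow]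
    simp
  refine ⟨(2 : ℝ) ^ ((1 : ℝ) / p), ⟨_, hirr.ne_zero, hroot⟩, ?_, by positivity⟩
  rw [← minpoly.eq_of_irreducible_of_monic hirr hroot
    (Polynomial.monic_X_pow_sub_C _ hp.ne_zero), Polynomial.natDegree_X_pow_sub_C]
  exact hkp

/-- Tuples of linearly independent real algebraic numbers are dense. -/
theorem IsOpen.exists_isAlgebraic_linearIndependent {k : ℕ} {O : Set (Fin k → ℝ)}
    (hO : IsOpen O) (hne : O.Nonempty) :
    ∃ x ∈ O, (∀ i, IsAlgebraic ℚ (x i)) ∧ LinearIndependent ℚ x := by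
  obtain ⟨z, hz⟩ := hne
  obtain ⟨ε, hε, hball⟩ := Metric.isOpen_iff.1 hO z hz
  obtain ⟨a, ha, hdeg, ha0⟩ := exists_isAlgebraic_natDegree_ge k
  have hs : ∀ i : Fin k, ∃ s : ℚ, s ≠ 0 ∧ |s * a ^ (i : ℕ) - z i| < ε := by
    intro i
    have hai : 0 < |a ^ (i : ℕ)| := abs_pos.2 (pow_ne_zero _ ha0)
    have hopen : IsOpen (Metric.ball (z i / a ^ (i : ℕ)) (ε / |a ^ (i : ℕ)|) ∩ {0}ᶜ) :=
      Metric.isOpen_ball.inter isOpen_compl_singleton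
    have hnon : (Metric.ball (z i / a ^ (i : ℕ)) (ε / |a ^ (i : ℕ)|) ∩ {0}ᶜ).Nonempty :=
      (dense_compl_singleton (0 : ℝ)).inter_open_nonempty _ Metric.isOpen_ball
        ⟨_, Metric.mem_ball_self (by positivity)⟩
    obtain ⟨_, ⟨h1, h2⟩, s, rfl⟩ :=
      Rat.denseRange_cast (𝕜 := ℝ) |>.inter_open_nonempty _ hopen hnon
    refine ⟨s, by simpa using h2, ?_⟩
    rw [Metric.mem_ball, Real.dist_eq, lt_div_iff₀ hai, ← abs_mul, sub_mul,
      div_mul_cancel₀ _ (pow_ne_zero _ ha0)] at h1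
    exact h1
  choose s hs0 hs using hs
  refine ⟨fun i => s i * a ^ (i : ℕ), hball ?_, fun i => ?_, ?_⟩
  · rw [Metric.mem_ball, dist_pi_lt_iff hε]
    exact fun i => by rw [Real.dist_eq]; exact hs i
  · have h1 : IsAlgebraic ℚ ((s i : ℚ) : ℝ) := isAlgebraic_algebraMap (A := ℝ) (s i)
    exact h1.mul (ha.pow _)
  · have h1 := (linearIndependent_pow (K := ℚ) a).comp (Fin.castLE hdeg) (Fin.castLE_injective _)
    have h2 := h1.units_smul fun i => Units.mk0 (s i) (hs0 i)
    have h3 : (fun i : Fin k => (s i : ℝ) * a ^ (i : ℕ)) = (fun i => Units.mk0 (s i) (hs0 i)) •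
        ((fun n : ℕ => a ^ n) ∘ (Fin.val : Fin (minpoly ℚ a).natDegree → ℕ) ∘ Fin.castLE hdeg) := by
      ext i
      simp [Units.smul_def, Rat.smul_def]
    rw [h3]
    exact h2

theorem IsOpen.exists_aeval_ne_zero {K : Type*} [Field K] [Algebra K ℝ] {k : ℕ}
    {O : Set (Fin k → ℝ)} (hO : IsOpen O) (hne : O.Nonempty) {C : MvPolynomial (Fin k) K}
    (hC : C ≠ 0) :
    ∃ x ∈ O, (∀ i, IsAlgebraic ℚ (x i)) ∧ LinearIndependent ℚ x ∧ MvPolynomial.aeval x C ≠ 0 := by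
  have hcont : Continuous fun x : Fin k → ℝ => MvPolynomial.aeval x C := by
    simp_rw [MvPolynomial.aeval_def, ← MvPolynomial.eval_map]
    exact MvPolynomial.continuous_eval _
  have hnon : (O ∩ {x | MvPolynomial.aeval x C ≠ 0}).Nonempty := by
    by_contra h
    rw [Set.not_nonempty_iff_eq_empty] at h
    obtain ⟨z, hz⟩ := hne
    obtain ⟨ε, hε, hball⟩ := Metric.isOpen_iff.1 hO z hz
    apply hC
    apply MvPolynomial.map_injective _ (algebraMap K ℝ).injective
    rw [map_zero]
    refine MvPolynomial.funext_set (fun i => Metric.ball (z i) ε) (fun i => ?_) fun x hx => ?_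
    · rw [Real.ball_eq_Ioo]
      exact Set.Ioo_infinite (by linarith)
    · rw [MvPolynomial.eval_map, ← MvPolynomial.aeval_def, map_zero]
      by_contra hx0
      have : x ∈ O ∩ {x | MvPolynomial.aeval x C ≠ 0} :=
        ⟨hball ((dist_pi_lt_iff hε).2 fun i => hx i (mem_univ i)), hx0⟩
      rw [h] at this
      exact this
  obtain ⟨x, hx, h1, h2⟩ :=
    (hO.inter (isOpen_ne_fun hcont continuous_const)).exists_isAlgebraic_linearIndependent hnon
  exact ⟨x, hx.1, h1, h2, hx.2⟩

open MvPolynomial in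
theorem MvPolynomial.eval₂_map_sumAlgEquiv {S₁ S₂ R L A : Type*} [CommRing R] [CommRing L]
    [CommRing A] (φ : R →+* L) (ψ : L →+* A) (y : S₁ → A) (x : S₂ → L)
    (B : MvPolynomial (S₁ ⊕ S₂) R) :
    eval₂ ψ y (map (eval₂Hom φ x) (sumAlgEquiv R S₁ S₂ B)) =
      eval₂ (ψ.comp φ) (Sum.elim y (ψ ∘ x)) B := by
  induction B using MvPolynomial.induction_on with
  | C a => simp
  | add p q hp hq => simp only [map_add, eval₂_add, hp, hq]
  | mul_X p i hp =>
    simp only [map_mul, eval₂_mul, hp, eval₂_X]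
    cases i <;> simp

open MvPolynomial in
/-- Specialisation of half of the variables of a polynomial at real algebraic numbers. -/
theorem RealAlgExt.exists_specialization {K : Subfield ℝ} (hK : RealAlgExt K) {S₁ S₂ : Type*}
    {x : S₂ → ℝ} (hx : ∀ i, IsAlgebraic ℚ (x i)) (Q : MvPolynomial (S₁ ⊕ S₂) K)
    {s : S₁ →₀ ℕ} (hs : aeval x (coeff s (sumAlgEquiv K S₁ S₂ Q)) ≠ 0) :
    ∃ R : MvPolynomial S₁ (algebraicClosure ℚ ℝ), R ≠ 0 ∧
      R.support ⊆ (sumAlgEquiv K S₁ S₂ Q).support ∧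
      ∀ y : S₁ → ℝ, aeval y R = aeval (Sum.elim y x) Q := by
  let φ : K →+* algebraicClosure ℚ ℝ := K.subtype.codRestrict (algebraicClosure ℚ ℝ)
    fun a => mem_algebraicClosure_iff.2 (hK a)
  let xL : S₂ → algebraicClosure ℚ ℝ := fun i => ⟨x i, mem_algebraicClosure_iff.2 (hx i)⟩
  let ψ : algebraicClosure ℚ ℝ →+* ℝ := algebraMap _ _
  refine ⟨map (eval₂Hom φ xL) (sumAlgEquiv K S₁ S₂ Q), MvPolynomial.ne_zero_iff.2 ⟨s, ?_⟩,
    support_map_subset _ _, fun y => MvPolynomial.eval₂_map_sumAlgEquiv φ ψ y xL Q⟩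
  rw [coeff_map]
  intro h0
  apply hs
  have h1 : ψ (eval₂Hom φ xL (coeff s (sumAlgEquiv K S₁ S₂ Q))) =
      aeval x (coeff s (sumAlgEquiv K S₁ S₂ Q)) := by
    rw [MvPolynomial.coe_eval₂Hom, MvPolynomial.hom_eval₂]
    rfl
  rw [← h1, h0, map_zero]

open MvPolynomial in
theorem MvPolynomial.exists_coeff_sumAlgEquiv_ne_zero {R S₁ S₂ : Type*} [CommRing R]
    {Q : MvPolynomial (S₁ ⊕ S₂) R} (hQ : Q ≠ 0) :
    ∃ s, coeff s (sumAlgEquiv R S₁ S₂ Q) ≠ 0 :=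
  MvPolynomial.ne_zero_iff.1 ((EmbeddingLike.map_ne_zero_iff (f := sumAlgEquiv R S₁ S₂)).2 hQ)

open Real MvPolynomial in
theorem SchanuelConjecture.exists_aeval_exp_ne_zero (hSch : SchanuelConjecture) {k : ℕ}
    {K : Subfield ℝ} (hK : RealAlgExt K) {C : MvPolynomial (Fin k ⊕ Fin k) K} (hC : C ≠ 0) :
    ∃ x : Fin k → ℝ, aeval (Sum.elim (fun i => exp (x i)) x) C ≠ 0 := by
  obtain ⟨c, hc⟩ := MvPolynomial.exists_coeff_sumAlgEquiv_ne_zero hC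
  obtain ⟨x, -, hxalg, hxlin, hxc⟩ := isOpen_univ.exists_aeval_ne_zero univ_nonempty hc
  have : Algebra.IsAlgebraic ℚ (algebraicClosure ℚ ℝ) := algebraicClosure.isAlgebraic ℚ ℝ
  obtain ⟨R, hR, -, hspec⟩ := hK.exists_specialization hxalg C hxc
  have hind := (hSch.algebraicIndependent_exp hxalg hxlin).extendScalars (algebraicClosure ℚ ℝ)
  refine ⟨x, fun h => hR ((injective_iff_map_eq_zero _).1 hind R ?_)⟩
  rw [hspec, h]

theorem analyticOnNhd_insertNth {k : ℕ} (i : Fin (k + 1)) {g : (Fin k → ℝ) → ℝ}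
    {s : Set (Fin k → ℝ)} (hg : AnalyticOnNhd ℝ g s) :
    AnalyticOnNhd ℝ (fun x => (i.insertNth (g x) x : Fin (k + 1) → ℝ)) s := by
  refine AnalyticOnNhd.pi (f := fun j x => (i.insertNth (g x) x : Fin (k + 1) → ℝ) j)
    ((Fin.forall_iff_succAbove i).2 ⟨?_, fun j => ?_⟩)
  · simpa using hg
  · simp only [Fin.insertNth_apply_succAbove]
    exact (ContinuousLinearMap.proj (R := ℝ) (φ := fun _ : Fin k => ℝ) j).analyticOnNhd _

theorem AnalyticOnNhd.dense_ne_zero {E : Type*} [NormedAddCommGroup E] [NormedSpace ℝ E]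
    {f : E → ℝ} (hf : AnalyticOnNhd ℝ f univ) {z : E} (hz : f z ≠ 0) :
    Dense {x | f x ≠ 0} := by
  intro x
  by_contra h
  have h1 : f =ᶠ[nhds x] 0 := by
    filter_upwards [isClosed_closure.isOpen_compl.mem_nhds h] with y hy
    by_contra h2
    exact hy (subset_closure h2)
  exact hz (hf.eqOn_zero_of_preconnected_of_eventuallyEq_zero isPreconnected_univ
    (mem_univ x) h1 (mem_univ z))

open Real MvPolynomial in
/-- Let `f` be an entire analytic function on `ℝ^{k+1}` on whose zero set the functions
`x_j, exp (x_j)` for `j ≠ i₀` and `x_{i₀}` (resp. `exp (x_{i₀})`) satisfy a nontrivial relation.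
If the zero set of `f` projects onto a set with nonempty interior along the `i₀`-th coordinate,
it contains a rational hyperplane. -/
theorem SchanuelConjecture.exists_hyperplane_subset (hSch : SchanuelConjecture) {k : ℕ}
    {K : Subfield ℝ} (hK : RealAlgExt K) {A B : MvPolynomial (Option (Fin k) ⊕ Fin k) K}
    (hA : A ≠ 0) (hB : B ≠ 0) (i₀ : Fin (k + 1)) {f : (Fin (k + 1) → ℝ) → ℝ}
    (hf : AnalyticOnNhd ℝ f univ)
    (hfA : ∀ (x : Fin k → ℝ) (t : ℝ), f (i₀.insertNth t x) = 0 →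
      aeval (Sum.elim (fun o : Option (Fin k) => o.elim t fun i => exp (x i)) x) A = 0)
    (hfB : ∀ (x : Fin k → ℝ) (t : ℝ), f (i₀.insertNth t x) = 0 →
      aeval (Sum.elim (fun o : Option (Fin k) => o.elim (exp t) fun i => exp (x i)) x) B = 0)
    {O : Set (Fin k → ℝ)} (hO : IsOpen O) (hne : O.Nonempty)
    (hfO : ∀ x ∈ O, ∃ t, f (i₀.insertNth t x) = 0) :
    ∃ q : Fin k → ℚ, ∀ x : Fin k → ℝ, f (i₀.insertNth (∑ i, (q i : ℝ) * x i) x) = 0 := by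
  obtain ⟨a, ha⟩ := MvPolynomial.exists_coeff_sumAlgEquiv_ne_zero hA
  obtain ⟨b, hb⟩ := MvPolynomial.exists_coeff_sumAlgEquiv_ne_zero hB
  set B' := sumAlgEquiv K (Option (Fin k)) (Fin k) B with hB'
  set F : Finset (Fin k → ℚ) := (B'.support ×ˢ B'.support).image fun s i =>
    ((s.2 (some i) : ℚ) - s.1 (some i)) / (s.1 none - s.2 none) with hF
  set g : (Fin k → ℚ) → (Fin k → ℝ) → ℝ := fun q x =>
    f (i₀.insertNth (∑ i, (q i : ℝ) * x i) x) with hg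
  have hgan : ∀ q, AnalyticOnNhd ℝ (g q) univ := by
    intro q
    refine hf.comp (analyticOnNhd_insertNth i₀ ?_) (mapsTo_univ _ _)
    exact Finset.analyticOnNhd_fun_sum _ fun i _ => analyticOnNhd_const.mul
      ((ContinuousLinearMap.proj (R := ℝ) (φ := fun _ : Fin k => ℝ) i).analyticOnNhd _)
  by_contra! hcon
  have hdense : Dense (⋂ q ∈ F, {x | g q x ≠ 0}) :=
    dense_biInter_of_isOpen (S := (F : Set (Fin k → ℚ)))
      (fun q _ => isOpen_ne_fun (hgan q).continuous continuous_const)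
      F.countable_toSet fun q _ => (hgan q).dense_ne_zero (hcon q).choose_spec
  have hopen : IsOpen (⋂ q ∈ F, {x | g q x ≠ 0}) := isOpen_biInter_finset fun q _ =>
    isOpen_ne_fun (hgan q).continuous continuous_const
  obtain ⟨x, ⟨hxO, hxF⟩, hxalg, hxlin, hxab⟩ := (hO.inter hopen).exists_aeval_ne_zero
    (hdense.inter_open_nonempty O hO hne) (mul_ne_zero ha hb)
  rw [map_mul] at hxab
  obtain ⟨t, ht⟩ := hfO x hxO
  have : Algebra.IsAlgebraic ℚ (algebraicClosure ℚ ℝ) := algebraicClosure.isAlgebraic ℚ ℝ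
  obtain ⟨A₁, hA₁, -, hA₂⟩ := hK.exists_specialization hxalg A (left_ne_zero_of_mul hxab)
  obtain ⟨B₁, hB₁, hBsupp, hB₂⟩ := hK.exists_specialization hxalg B (right_ne_zero_of_mul hxab)
  have hnot : ∀ (y : Option (Fin k) → ℝ) (Q : MvPolynomial (Option (Fin k)) (algebraicClosure ℚ ℝ)),
      Q ≠ 0 → aeval y Q = 0 → ¬ AlgebraicIndependent (algebraicClosure ℚ ℝ) y := fun y Q hQ hy h =>
    hQ ((injective_iff_map_eq_zero _).1 h Q hy)
  obtain ⟨q, rfl⟩ := hSch.exists_eq_sum hxalg hxlin (algebraicClosure ℚ ℝ)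
    (hnot _ _ hA₁ ((hA₂ _).trans (hfA x t ht))) (hnot _ _ hB₁ ((hB₂ _).trans (hfB x t ht)))
  obtain ⟨s, hs, s', hs', hq⟩ := hSch.exists_mem_support hxalg hxlin (algebraicClosure ℚ ℝ) q hB₁
    ((hB₂ _).trans (hfB x _ ht))
  have hqF : q ∈ F := Finset.mem_image.2 ⟨(s, s'), Finset.mem_product.2
    ⟨hBsupp hs, hBsupp hs'⟩, hq.symm⟩
  exact mem_iInter₂.1 hxF q hqF ht

theorem coeffsIn_iff_exists_map {σ : Type*} {K : Subfield ℝ} {P : MvPolynomial σ ℝ} :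
    CoeffsIn K P ↔ ∃ Q : MvPolynomial σ K, MvPolynomial.map (algebraMap K ℝ) Q = P := by
  refine Iff.trans ?_ (MvPolynomial.mem_range_map_iff_coeffs_subset (f := algebraMap K ℝ)).symm
  have hr : ∀ a : ℝ, a ∈ range (algebraMap K ℝ) ↔ a ∈ K := fun a =>
    ⟨fun ⟨b, hb⟩ => hb ▸ b.2, fun h => ⟨⟨a, h⟩, rfl⟩⟩
  constructor
  · intro h a ha
    obtain ⟨m, -, rfl⟩ := MvPolynomial.mem_coeffs_iff.1 ha
    exact (hr _).2 (h m)
  · intro h m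
    by_cases hm : P.coeff m = 0
    · rw [hm]
      exact K.zero_mem
    · exact (hr _).1 (h (MvPolynomial.mem_coeffs_iff.2 ⟨m, MvPolynomial.mem_support_iff.2 hm, rfl⟩))

/-- The graph map of the exponential. -/
def expGraph {n : ℕ} (x : Fin n → ℝ) : Fin n ⊕ Fin n → ℝ :=
  Sum.elim x fun i => Real.exp (x i)

theorem isAlgSet_iff {σ : Type*} {K : Subfield ℝ} {S : Set (σ → ℝ)} :
    IsAlgSet K S ↔ ∃ Q : MvPolynomial σ K, S = {x | MvPolynomial.aeval x Q = 0} := by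
  constructor
  · rintro ⟨P, hP, rfl⟩
    obtain ⟨Q, rfl⟩ := coeffsIn_iff_exists_map.1 hP
    exact ⟨Q, by simp_rw [MvPolynomial.eval_map, MvPolynomial.aeval_def]⟩
  · rintro ⟨Q, rfl⟩
    exact ⟨_, coeffsIn_iff_exists_map.2 ⟨Q, rfl⟩, by
      simp_rw [MvPolynomial.eval_map, MvPolynomial.aeval_def]⟩

theorem isExpSet_iff {n : ℕ} {K : Subfield ℝ} {S : Set (Fin n → ℝ)} :
    IsExpSet K S ↔ ∃ Q : MvPolynomial (Fin n ⊕ Fin n) K,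
      S = {x | MvPolynomial.aeval (expGraph x) Q = 0} := by
  constructor
  · rintro ⟨P, hP, rfl⟩
    obtain ⟨Q, rfl⟩ := coeffsIn_iff_exists_map.1 hP
    exact ⟨Q, by simp_rw [expEval, MvPolynomial.eval_map, MvPolynomial.aeval_def, expGraph]⟩
  · rintro ⟨Q, rfl⟩
    exact ⟨_, coeffsIn_iff_exists_map.2 ⟨Q, rfl⟩, by
      simp_rw [expEval, MvPolynomial.eval_map, MvPolynomial.aeval_def, expGraph]⟩

open MvPolynomial in
theorem MvPolynomial.isPrime_vanishingIdeal {K : Subfield ℝ} {σ X : Type*} (e : X → σ → ℝ)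
    {Q : MvPolynomial σ K} {V : Set X} (hV : V = {x | aeval (e x) Q = 0}) (hne : V.Nonempty)
    (hirr : ∀ Q₁ Q₂ : MvPolynomial σ K,
      V = {x | aeval (e x) Q₁ = 0} ∪ {x | aeval (e x) Q₂ = 0} →
      V = {x | aeval (e x) Q₁ = 0} ∨ V = {x | aeval (e x) Q₂ = 0}) :
    (vanishingIdeal K (e '' V)).IsPrime where
  ne_top' h := by
    obtain ⟨x, hx⟩ := hne
    have h1 : (1 : MvPolynomial σ K) ∈ vanishingIdeal K (e '' V) := h ▸ Submodule.mem_top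
    simpa using h1 _ ⟨x, hx, rfl⟩
  mem_or_mem' := by
    intro a b hab
    have hinter : ∀ c : MvPolynomial σ K,
        {x | aeval (e x) (Q * Q + c * c) = 0} = V ∩ {x | aeval (e x) c = 0} := by
      intro c
      ext x
      simp only [hV, map_add, map_mul, mem_ofPred_eq, mem_inter_iff]
      constructor
      · intro h
        exact ⟨by nlinarith [mul_self_nonneg (aeval (e x) Q), mul_self_nonneg (aeval (e x) c)],
          by nlinarith [mul_self_nonneg (aeval (e x) Q), mul_self_nonneg (aeval (e x) c)]⟩
      · rintro ⟨h1, h2⟩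
        simp [h1, h2]
    have hmem : ∀ c : MvPolynomial σ K, V = V ∩ {x | aeval (e x) c = 0} →
        c ∈ vanishingIdeal K (e '' V) := by
      rintro c hc _ ⟨x, hx, rfl⟩
      rw [hc] at hx
      exact hx.2
    refine (hirr (Q * Q + a * a) (Q * Q + b * b) ?_).imp
      (fun h => hmem a (h.trans (hinter a))) (fun h => hmem b (h.trans (hinter b)))
    rw [hinter, hinter, ← inter_union_distrib_left, eq_comm, inter_eq_left]
    intro x hx
    have := hab _ ⟨x, hx, rfl⟩
    rw [map_mul] at this
    exact mul_eq_zero.1 this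

theorem IsIrredAlgSet.isPrime_vanishingIdeal {σ : Type*} {K : Subfield ℝ} {V : Set (σ → ℝ)}
    (h : IsIrredAlgSet K V) : (MvPolynomial.vanishingIdeal K V).IsPrime := by
  obtain ⟨h1, hne, hirr⟩ := h
  obtain ⟨Q, hQ⟩ := isAlgSet_iff.1 h1
  have := MvPolynomial.isPrime_vanishingIdeal id hQ hne fun Q₁ Q₂ hu => by
    by_contra! hcon
    exact hirr ⟨_, _, isAlgSet_iff.2 ⟨Q₁, rfl⟩, isAlgSet_iff.2 ⟨Q₂, rfl⟩, hu,
      (subset_union_left.trans hu.ge).ssubset_of_ne hcon.1.symm,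
      (subset_union_right.trans hu.ge).ssubset_of_ne hcon.2.symm⟩
  rwa [image_id] at this

theorem IsIrredExpSet.isPrime_vanishingIdeal {n : ℕ} {K : Subfield ℝ} {V : Set (Fin n → ℝ)}
    (h : IsIrredExpSet K V) : (MvPolynomial.vanishingIdeal K (expGraph '' V)).IsPrime := by
  obtain ⟨h1, hne, hirr⟩ := h
  obtain ⟨Q, hQ⟩ := isExpSet_iff.1 h1
  exact MvPolynomial.isPrime_vanishingIdeal expGraph hQ hne fun Q₁ Q₂ hu => by
    by_contra! hcon
    exact hirr ⟨_, _, isExpSet_iff.2 ⟨Q₁, rfl⟩, isExpSet_iff.2 ⟨Q₂, rfl⟩, hu,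
      (subset_union_left.trans hu.ge).ssubset_of_ne hcon.1.symm,
      (subset_union_right.trans hu.ge).ssubset_of_ne hcon.2.symm⟩

open MvPolynomial in
theorem MvPolynomial.algebraicIndependent_mk_vanishingIdeal {K : Subfield ℝ} {σ ι : Type*}
    {S : Set (σ → ℝ)} {v : ι → σ} :
    AlgebraicIndependent K (fun i => Ideal.Quotient.mkₐ K (vanishingIdeal K S) (X (v i))) ↔
      ∀ A : MvPolynomial ι K, (∀ z ∈ S, aeval (z ∘ v) A = 0) → A = 0 := by
  rw [algebraicIndependent_iff]
  refine forall_congr' fun A => ?_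
  have h1 : aeval (fun i => Ideal.Quotient.mkₐ K (vanishingIdeal K S) (X (v i))) A =
      Ideal.Quotient.mkₐ K (vanishingIdeal K S) (rename v A) :=
    ((DFunLike.congr_fun (aeval_unique _) (rename v A)).trans (aeval_rename ..)).symm
  rw [h1, Ideal.Quotient.mkₐ_eq_mk, Ideal.Quotient.eq_zero_iff_mem, mem_vanishingIdeal_iff]
  simp_rw [aeval_rename]

theorem analyticOnNhd_aeval_expGraph {n : ℕ} {K : Subfield ℝ}
    (Q : MvPolynomial (Fin n ⊕ Fin n) K) :
    AnalyticOnNhd ℝ (fun x : Fin n → ℝ => MvPolynomial.aeval (expGraph x) Q) univ := by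
  refine AnalyticOnNhd.aeval_mvPolynomial (f := fun x : Fin n → ℝ => expGraph x) ?_ Q
  have hproj : ∀ i : Fin n, AnalyticOnNhd ℝ (fun x : Fin n → ℝ => x i) univ := fun i =>
    (ContinuousLinearMap.proj (R := ℝ) (φ := fun _ : Fin n => ℝ) i).analyticOnNhd _
  rintro (i | i)
  · exact hproj i
  · exact (hproj i).rexp

theorem ContinuousLinearMap.isInvertible_of_apply_one_ne_zero {𝕜 : Type*}
    [NontriviallyNormedField 𝕜] (L : 𝕜 →L[𝕜] 𝕜) (h : L 1 ≠ 0) : L.IsInvertible :=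
  ⟨ContinuousLinearEquiv.unitsEquivAut 𝕜 (Units.mk0 _ h), by ext; simp⟩

open Topology in
/-- Local parametrisation of the regular part of an analytic hypersurface as a graph. -/
theorem AnalyticAt.exists_eventually_eq_insertNth {l : ℕ} {g : (Fin (l + 1) → ℝ) → ℝ}
    {q : Fin (l + 1) → ℝ} (hg : AnalyticAt ℝ g q) (hq : g q = 0) (hd : fderiv ℝ g q ≠ 0) :
    ∃ (i : Fin (l + 1)) (φ : (Fin l → ℝ) → ℝ), AnalyticAt ℝ φ (i.removeNth q) ∧
      ∀ᶠ x in 𝓝 q, g x = 0 → i.insertNth (φ (i.removeNth x)) (i.removeNth x) = x := by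
  obtain ⟨i, hi⟩ : ∃ i, fderiv ℝ g q (Pi.single i 1) ≠ 0 := by
    by_contra! h
    apply hd
    ext x
    rw [pi_eq_sum_univ' x, map_sum]
    simp [h]
  let ι : (Fin l → ℝ) × ℝ →L[ℝ] (Fin (l + 1) → ℝ) := ContinuousLinearMap.pi
    (i.insertNth (ContinuousLinearMap.snd ℝ (Fin l → ℝ) ℝ) fun j =>
      (ContinuousLinearMap.proj (R := ℝ) (φ := fun _ : Fin l => ℝ) j).comp
        (ContinuousLinearMap.fst ℝ (Fin l → ℝ) ℝ))
  have hι : ∀ p, ι p = i.insertNth p.2 p.1 := by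
    intro p
    ext j
    rcases Fin.eq_self_or_eq_succAbove i j with rfl | ⟨j, rfl⟩ <;> simp [ι]
  have hιq : ι (i.removeNth q, q i) = q := by rw [hι, Fin.insertNth_self_removeNth]
  have hgι : AnalyticAt ℝ (g ∘ ι) (i.removeNth q, q i) :=
    AnalyticAt.comp (by rwa [hιq]) (ι.analyticAt _)
  have hfd : fderiv ℝ (g ∘ ι) (i.removeNth q, q i) = (fderiv ℝ g q).comp ι := by
    rw [fderiv_comp _ (by rw [hιq]; exact hg.differentiableAt) ι.differentiableAt, hιq, ι.fderiv]
  have hinv : (fderiv ℝ (g ∘ ι) (i.removeNth q, q i) ∘L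
      .inr ℝ (Fin l → ℝ) ℝ).IsInvertible := by
    apply ContinuousLinearMap.isInvertible_of_apply_one_ne_zero
    rw [hfd]
    convert hi using 1
    simp only [ContinuousLinearMap.comp_apply, hι]
    congr 1
    ext j
    rcases Fin.eq_self_or_eq_succAbove i j with rfl | ⟨j, rfl⟩ <;> simp
  have hC : ContDiffAt ℝ ⊤ (g ∘ ι) (i.removeNth q, q i) := hgι.contDiffAt
  refine ⟨i, hC.implicitFunction (by simp) hinv,
    (hC.contDiffAt_implicitFunction (by simp) hinv).analyticAt, ?_⟩
  have hcont : Filter.Tendsto (fun x : Fin (l + 1) → ℝ => (i.removeNth x, x i)) (𝓝 q)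
      (𝓝 (i.removeNth q, q i)) := by
    apply Continuous.tendsto (f := fun x : Fin (l + 1) → ℝ => (i.removeNth x, x i))
    unfold Fin.removeNth
    fun_prop
  filter_upwards [hcont.eventually
    (hC.eventually_apply_eq_iff_implicitFunction (by simp) hinv)] with x hx hgx
  have h1 : hC.implicitFunction (by simp) hinv (i.removeNth x) = x i := by
    refine hx.1 ?_
    simp only [Function.comp_apply, hι, Fin.insertNth_self_removeNth]
    rw [hgx, hq]
  rw [h1, Fin.insertNth_self_removeNth]

open Topology in
theorem AnalyticAt.iteratedDeriv_comp_line {E : Type*} [NormedAddCommGroup E] [NormedSpace ℝ E]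
    {p : E} (v : E) (m : ℕ) : ∀ {f : E → ℝ}, AnalyticAt ℝ f p →
      AnalyticAt ℝ ((fun (g : E → ℝ) x => fderiv ℝ g x v)^[m] f) p ∧
      iteratedDeriv m (fun t : ℝ => f (p + t • v)) 0 =
        (fun (g : E → ℝ) x => fderiv ℝ g x v)^[m] f p := by
  induction m with
  | zero => intro f hf; simpa using hf
  | succ m ih =>
    intro f hf
    have hD : AnalyticAt ℝ (fun x => fderiv ℝ f x v) p :=
      ((ContinuousLinearMap.apply ℝ ℝ v).analyticAt _).comp hf.fderiv
    rw [Function.iterate_succ_apply, iteratedDeriv_succ']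
    refine ⟨(ih hD).1, Eq.trans ?_ (ih hD).2⟩
    apply Filter.EventuallyEq.iteratedDeriv_eq
    have hcont : Filter.Tendsto (fun t : ℝ => p + t • v) (𝓝 0) (𝓝 p) := by
      have : Continuous fun t : ℝ => p + t • v := by fun_prop
      simpa using this.tendsto 0
    filter_upwards [hcont.eventually hf.eventually_analyticAt] with t ht
    have h1 : HasDerivAt (fun t : ℝ => p + t • v) v t := by
      simpa using ((hasDerivAt_id t).smul_const v).const_add p
    exact (ht.differentiableAt.hasFDerivAt.comp_hasDerivAt t h1).deriv

open Topology in
theorem AnalyticAt.exists_iterate_fderiv_ne_zero {E : Type*} [NormedAddCommGroup E]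
    [NormedSpace ℝ E] {f : E → ℝ} {p : E} (hf : AnalyticAt ℝ f p) (h0 : ¬ f =ᶠ[𝓝 p] 0) :
    ∃ (v : E) (m : ℕ), (fun (g : E → ℝ) x => fderiv ℝ g x v)^[m] f p ≠ 0 := by
  by_contra! h
  apply h0
  obtain ⟨r, hr, hball⟩ := hf.exists_ball_analyticOnNhd
  filter_upwards [Metric.ball_mem_nhds p hr] with y hy
  set v := y - p with hv
  set U : Set ℝ := (fun t : ℝ => p + t • v) ⁻¹' Metric.ball p r with hU
  have hUconv : Convex ℝ U := by
    have h1 : U = (AffineMap.lineMap p y : ℝ →ᵃ[ℝ] E) ⁻¹' Metric.ball p r := by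
      ext t
      rw [hU, mem_preimage, mem_preimage, AffineMap.lineMap_apply, vsub_eq_sub, vadd_eq_add,
        ← hv, add_comm]
    rw [h1]
    exact (convex_ball p r).affine_preimage _
  have hu : AnalyticOnNhd ℝ (fun t : ℝ => f (p + t • v)) U := by
    refine hball.comp (g := f) (f := fun t : ℝ => p + t • v) ?_ fun t ht => ht
    exact fun t _ => analyticAt_const.add (analyticAt_id.smul analyticAt_const)
  have h0U : (0 : ℝ) ∈ U := by simpa [hU] using hr
  have h1U : (1 : ℝ) ∈ U := by simpa [hU, hv] using hy
  have htop : analyticOrderAt (fun t : ℝ => f (p + t • v)) 0 = ⊤ := by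
    rw [ENat.eq_top_iff_forall_ge]
    intro m
    rw [natCast_le_analyticOrderAt_iff_iteratedDeriv_eq_zero (hu 0 h0U)]
    intro i _
    rw [(AnalyticAt.iteratedDeriv_comp_line v i hf).2, h]
  have := hu.eqOn_zero_of_preconnected_of_eventuallyEq_zero hUconv.isPreconnected h0U
    (analyticOrderAt_eq_top.1 htop) h1U
  simpa [hv] using this

/-- The regular part of the zero set of an analytic function. -/
def regularZeros {E : Type*} [NormedAddCommGroup E] [NormedSpace ℝ E] (g : E → ℝ) : Set E :=
  {x | AnalyticAt ℝ g x ∧ g x = 0 ∧ fderiv ℝ g x ≠ 0}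

open Topology in
theorem AnalyticAt.eventually_mem_regularZeros {E : Type*} [NormedAddCommGroup E]
    [NormedSpace ℝ E] {f : E → ℝ} {p : E} (hf : AnalyticAt ℝ f p) (h0 : ¬ f =ᶠ[𝓝 p] 0) :
    ∃ g : ℕ → E → ℝ, ∀ᶠ x in 𝓝 p, f x = 0 → ∃ j, x ∈ regularZeros (g j) := by
  obtain ⟨v, m, hm⟩ := hf.exists_iterate_fderiv_ne_zero h0
  set g : ℕ → E → ℝ := fun j => (fun (g : E → ℝ) x => fderiv ℝ g x v)^[j] f with hg
  refine ⟨g, ?_⟩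
  filter_upwards [hf.eventually_analyticAt,
    (AnalyticAt.iteratedDeriv_comp_line v m hf).1.continuousAt.eventually_ne hm] with x hx hxm hfx
  classical
  have hex : ∃ j, g j x ≠ 0 := ⟨m, hxm⟩
  have hfind := Nat.find_spec hex
  obtain ⟨j, hj⟩ : ∃ j, Nat.find hex = j + 1 := by
    apply Nat.exists_eq_succ_of_ne_zero
    intro h
    rw [h] at hfind
    exact hfind hfx
  refine ⟨j, (AnalyticAt.iteratedDeriv_comp_line v j hx).1, ?_, fun h => ?_⟩
  · by_contra h
    have := Nat.find_min' hex h
    omega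
  · apply hfind
    rw [hj]
    simp only [hg, Function.iterate_succ_apply']
    change fderiv ℝ (g j) x v = 0
    rw [h]
    rfl

open Topology in
theorem dimH_le_of_forall_exists_mem_nhdsWithin {X : Type*} [EMetricSpace X]
    [SecondCountableTopology X] {s : Set X} {r : ℝ≥0∞}
    (h : ∀ x ∈ s, ∃ t ∈ 𝓝[s] x, dimH t ≤ r) : dimH s ≤ r := by
  by_contra! hr
  obtain ⟨x, hx, hx'⟩ := exists_mem_nhdsWithin_lt_dimH_of_lt_dimH hr
  obtain ⟨t, ht, htr⟩ := h x hx
  exact absurd (hx' t ht) htr.not_gt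

open Topology in
theorem exists_mem_nhdsWithin_dimH_le {l : ℕ} {A : Set (Fin (l + 1) → ℝ)} {q : Fin (l + 1) → ℝ}
    (i : Fin (l + 1)) {φ : (Fin l → ℝ) → ℝ} (hφ : AnalyticAt ℝ φ (i.removeNth q))
    (hA : ∀ᶠ x in 𝓝 q, x ∈ A → i.insertNth (φ (i.removeNth x)) (i.removeNth x) = x)
    {N : Set (Fin l → ℝ)} (hN : N ∈ 𝓝 (i.removeNth q)) {r : ℝ≥0∞}
    (hr : dimH (N ∩ {x | (i.insertNth (φ x) x : Fin (l + 1) → ℝ) ∈ A}) ≤ r) :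
    ∃ t ∈ 𝓝[A] q, dimH t ≤ r := by
  set ψ : (Fin l → ℝ) → Fin (l + 1) → ℝ := fun x => i.insertNth (φ x) x with hψ
  have hψan : AnalyticAt ℝ ψ (i.removeNth q) :=
    analyticOnNhd_insertNth i (s := {i.removeNth q}) (fun x hx => hx ▸ hφ) _ rfl
  obtain ⟨C, N', hN', hlip⟩ := (hψan.contDiffAt (n := 1)).exists_lipschitzOnWith
  have hcont : Continuous fun x : Fin (l + 1) → ℝ => (i.removeNth x : Fin l → ℝ) := by
    unfold Fin.removeNth
    fun_prop
  refine ⟨ψ '' (N' ∩ (N ∩ {x | ψ x ∈ A})), ?_,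
    ((hlip.mono inter_subset_left).dimH_image_le).trans ((dimH_mono inter_subset_right).trans hr)⟩
  rw [mem_nhdsWithin_iff_eventually]
  filter_upwards [hA, hcont.continuousAt.eventually hN', hcont.continuousAt.eventually hN]
    with x h1 h2 h3 hxA
  exact ⟨i.removeNth x, ⟨h2, h3, by simpa [hψ, h1 hxA] using hxA⟩, h1 hxA⟩

open Topology in
theorem AnalyticAt.exists_mem_nhds_dimH_le {l : ℕ} {h : (Fin (l + 1) → ℝ) → ℝ}
    {p : Fin (l + 1) → ℝ} (hh : AnalyticAt ℝ h p) (h0 : ¬ h =ᶠ[𝓝 p] 0) :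
    ∃ N ∈ 𝓝 p, dimH (N ∩ {x | h x = 0}) ≤ l := by
  obtain ⟨g, hg⟩ := hh.eventually_mem_regularZeros h0
  refine ⟨_, hg, (dimH_mono (t := ⋃ j, regularZeros (g j)) ?_).trans ?_⟩
  · rintro x ⟨h1, h2⟩
    exact mem_iUnion.2 (h1 h2)
  · rw [dimH_iUnion]
    refine iSup_le fun j => dimH_le_of_forall_exists_mem_nhdsWithin fun q hq => ?_
    obtain ⟨i, φ, hφ, hev⟩ := hq.1.exists_eventually_eq_insertNth hq.2.1 hq.2.2
    refine exists_mem_nhdsWithin_dimH_le i hφ (hev.mono fun x hx hxA => hx hxA.2.1)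
      Filter.univ_mem ?_
    exact (dimH_mono (subset_univ _)).trans (Real.dimH_univ_pi_fin l).le

open Topology in
/-- If the zero set of an analytic function on `ℝ^{k+1}` has dimension `k`, one of its
projections along a coordinate has nonempty interior. -/
theorem AnalyticOnNhd.exists_isOpen_forall_exists_insertNth {k : ℕ} {f : (Fin (k + 1) → ℝ) → ℝ}
    (hf : AnalyticOnNhd ℝ f univ) (hf0 : ∃ x, f x ≠ 0) (hne : {x | f x = 0}.Nonempty)
    (hdim : dimH {x | f x = 0} = k) :
    ∃ (i : Fin (k + 1)) (O : Set (Fin k → ℝ)), IsOpen O ∧ O.Nonempty ∧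
      ∀ x ∈ O, ∃ t, f (i.insertNth t x) = 0 := by
  cases k with
  | zero =>
    obtain ⟨z, hz⟩ := hne
    refine ⟨0, univ, isOpen_univ, univ_nonempty, fun x _ => ⟨z 0, ?_⟩⟩
    rw [Subsingleton.elim x (Fin.removeNth 0 z), Fin.insertNth_self_removeNth]
    exact hz
  | succ l =>
    by_contra! hcon
    have hle : dimH {x | f x = 0} ≤ l := by
      refine dimH_le_of_forall_exists_mem_nhdsWithin fun p hp => ?_
      have hp0 : ¬ f =ᶠ[𝓝 p] 0 := fun h => by
        obtain ⟨x, hx⟩ := hf0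
        exact hx (hf.eqOn_zero_of_preconnected_of_eventuallyEq_zero isPreconnected_univ
          (mem_univ p) h (mem_univ x))
      obtain ⟨g, hg⟩ := (hf p (mem_univ p)).eventually_mem_regularZeros hp0
      refine ⟨⋃ j, regularZeros (g j) ∩ {x | f x = 0}, ?_, ?_⟩
      · rw [mem_nhdsWithin_iff_eventually]
        filter_upwards [hg] with x hx hfx
        obtain ⟨j, hj⟩ := hx hfx
        exact mem_iUnion.2 ⟨j, hj, hfx⟩
      rw [dimH_iUnion]
      refine iSup_le fun j => dimH_le_of_forall_exists_mem_nhdsWithin fun q hq => ?_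
      obtain ⟨i, φ, hφ, hev⟩ := hq.1.1.exists_eventually_eq_insertNth hq.1.2.1 hq.1.2.2
      have hh : AnalyticAt ℝ (fun x => f (i.insertNth (φ x) x)) (i.removeNth q) :=
        (hf _ (mem_univ _)).comp
          (analyticOnNhd_insertNth i (s := {i.removeNth q}) (fun x hx => hx ▸ hφ) _ rfl)
      have hh0 : ¬ (fun x => f (i.insertNth (φ x) x)) =ᶠ[𝓝 (i.removeNth q)] 0 := by
        intro h
        obtain ⟨O, hO1, hO2, hO3⟩ := mem_nhds_iff.1 h
        obtain ⟨x, hxO, hx⟩ := hcon i O hO2 ⟨_, hO3⟩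
        exact hx _ (hO1 hxO)
      obtain ⟨N, hN, hNdim⟩ := hh.exists_mem_nhds_dimH_le hh0
      refine exists_mem_nhdsWithin_dimH_le i hφ (hev.mono fun x hx hxA => hx hxA.1.2.1) hN
        ((dimH_mono ?_).trans hNdim)
      exact inter_subset_inter_right _ fun x hx => hx.2
    rw [hdim] at hle
    have : l + 1 ≤ l := by exact_mod_cast hle
    omega

/-- Clearing denominators in the equation of a rational hyperplane. -/
theorem exists_int_sum_eq_zero_iff {k : ℕ} (i₀ : Fin (k + 1)) (q : Fin k → ℚ) :
    ∃ m : Fin (k + 1) → ℤ, (∃ i, m i ≠ 0) ∧ ∀ x : Fin (k + 1) → ℝ,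
      ∑ i, (m i : ℝ) * x i = 0 ↔ x i₀ = ∑ j, (q j : ℝ) * x (i₀.succAbove j) := by
  set N : ℕ := ∏ i, (q i).den with hN
  have hN0 : N ≠ 0 := Finset.prod_ne_zero_iff.2 fun i _ => (q i).den_nz
  have hM : ∀ i, ∃ M : ℤ, (M : ℚ) = q i * N := by
    intro i
    obtain ⟨c, hc⟩ : (q i).den ∣ N := Finset.dvd_prod_of_mem _ (Finset.mem_univ i)
    refine ⟨(q i).num * c, ?_⟩
    rw [hc]
    push_cast
    rw [← mul_assoc, Rat.mul_den_eq_num]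
  choose M hM using hM
  refine ⟨i₀.insertNth (N : ℤ) fun j => -M j, ⟨i₀, by simpa using hN0⟩, fun x => ?_⟩
  have hMR : ∀ j, (M j : ℝ) = q j * N := fun j => by
    exact_mod_cast congrArg (Rat.cast (K := ℝ)) (hM j)
  rw [Fin.sum_univ_succAbove _ i₀]
  simp only [Fin.insertNth_apply_same, Fin.insertNth_apply_succAbove, Int.cast_neg,
    Int.cast_natCast, hMR]
  have h1 : ∑ j, -((q j : ℝ) * N) * x (i₀.succAbove j) =
      -(N * ∑ j, (q j : ℝ) * x (i₀.succAbove j)) := by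
    rw [Finset.mul_sum, ← Finset.sum_neg_distrib]
    exact Finset.sum_congr rfl fun j _ => by ring
  have hNR : (N : ℝ) ≠ 0 := by exact_mod_cast hN0
  rw [h1, ← sub_eq_add_neg, ← mul_sub, mul_eq_zero, or_iff_right hNR, sub_eq_zero]

open MvPolynomial in
theorem SchanuelConjecture.eq_rational_hyperplane (hSch : SchanuelConjecture) {k : ℕ}
    {K : Subfield ℝ} (hK : RealAlgExt K) {T : Set (Fin (k + 1) → ℝ)} (hT : IsIrredExpSet K T)
    (hdim : dimH T = k) {I : Ideal (MvPolynomial (Fin (k + 1) ⊕ Fin (k + 1)) K)} [I.IsPrime]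
    (hI : I ≠ ⊥) (hIT : I < vanishingIdeal K (expGraph '' T)) :
    ∃ m : Fin (k + 1) → ℤ, (∃ i, m i ≠ 0) ∧ T = {x | ∑ i, (m i : ℝ) * x i = 0} := by
  obtain ⟨Q, hQ⟩ := isExpSet_iff.1 hT.1
  have hprime := hT.isPrime_vanishingIdeal
  have hf0 : ∃ x, aeval (expGraph x) Q ≠ 0 := by
    by_contra! h
    rw [hQ.trans (eq_univ_of_forall h), Real.dimH_univ_pi_fin] at hdim
    have : k + 1 = k := by exact_mod_cast hdim
    omega
  obtain ⟨i₀, O, hO, hne, hfO⟩ :=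
    (analyticOnNhd_aeval_expGraph Q).exists_isOpen_forall_exists_insertNth hf0
      (hQ ▸ hT.2.1) (hQ ▸ hdim)
  set vA : Option (Fin k) ⊕ Fin k → Fin (k + 1) ⊕ Fin (k + 1) := Sum.elim
    (fun o => o.elim (Sum.inl i₀) fun j => Sum.inr (i₀.succAbove j))
    fun j => Sum.inl (i₀.succAbove j) with hvA
  set vB : Option (Fin k) ⊕ Fin k → Fin (k + 1) ⊕ Fin (k + 1) := Sum.elim
    (fun o => o.elim (Sum.inr i₀) fun j => Sum.inr (i₀.succAbove j))
    fun j => Sum.inl (i₀.succAbove j) with hvB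
  set vC : Fin k ⊕ Fin k → Fin (k + 1) ⊕ Fin (k + 1) :=
    Sum.elim (fun j => Sum.inr (i₀.succAbove j)) fun j => Sum.inl (i₀.succAbove j) with hvC
  have hrel : ∀ v : Option (Fin k) ⊕ Fin k → Fin (k + 1) ⊕ Fin (k + 1),
      ∃ A : MvPolynomial (Option (Fin k) ⊕ Fin k) K,
        (∀ x ∈ T, aeval (expGraph x ∘ v) A = 0) ∧ A ≠ 0 := by
    intro v
    have h1 := not_algebraicIndependent_mk_of_lt hI hIT (ι := Option (Fin k) ⊕ Fin k)
      (by simp; omega) (fun i => X (v i))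
    rw [algebraicIndependent_mk_vanishingIdeal] at h1
    push Not at h1
    obtain ⟨A, hA, hA0⟩ := h1
    exact ⟨A, fun x hx => hA _ ⟨x, hx, rfl⟩, hA0⟩
  obtain ⟨A, hA, hA0⟩ := hrel vA
  obtain ⟨B, hB, hB0⟩ := hrel vB
  obtain ⟨q, hq⟩ := hSch.exists_hyperplane_subset hK hA0 hB0 i₀ (analyticOnNhd_aeval_expGraph Q)
    (fun x t h => by
      have := hA _ (hQ.ge h)
      convert this using 2
      ext ((_ | _) | _) <;> simp [hvA, expGraph])
    (fun x t h => by
      have := hB _ (hQ.ge h)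
      convert this using 2
      ext ((_ | _) | _) <;> simp [hvB, expGraph]) hO hne hfO
  obtain ⟨m, hm, hmq⟩ := exists_int_sum_eq_zero_iff i₀ q
  refine ⟨m, hm, ?_⟩
  set H : Set (Fin (k + 1) → ℝ) := {x | ∑ i, (m i : ℝ) * x i = 0} with hH
  have hHT : H ⊆ T := by
    intro x hx
    have h1 := hq (i₀.removeNth x)
    have h2 : x i₀ = ∑ j, (q j : ℝ) * i₀.removeNth x j := (hmq x).1 hx
    rw [← h2, Fin.insertNth_self_removeNth] at h1
    exact hQ.ge h1
  refine subset_antisymm ?_ hHT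
  by_contra hTH
  set ℓ : MvPolynomial (Fin (k + 1) ⊕ Fin (k + 1)) K := ∑ i, C (m i : K) * X (Sum.inl i) with hℓ
  have hℓeval : ∀ x : Fin (k + 1) → ℝ, aeval (expGraph x) ℓ = ∑ i, (m i : ℝ) * x i := by
    intro x
    simp [hℓ, expGraph]
  have hlt : vanishingIdeal K (expGraph '' T) < vanishingIdeal K (expGraph '' H) := by
    refine lt_of_le_of_ne (vanishingIdeal_anti_mono (image_mono hHT)) fun heq => hTH ?_
    have h1 : ℓ ∈ vanishingIdeal K (expGraph '' H) := by
      rintro _ ⟨x, hx, rfl⟩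
      rw [hℓeval]
      exact hx
    rw [← heq] at h1
    intro x hx
    have := h1 _ ⟨x, hx, rfl⟩
    rwa [hℓeval] at this
  have h1 := not_algebraicIndependent_mk_of_lt_of_lt hI hIT hlt (ι := Fin k ⊕ Fin k)
    (by simp; omega) (fun i => X (vC i))
  rw [algebraicIndependent_mk_vanishingIdeal] at h1
  push Not at h1
  obtain ⟨D, hD, hD0⟩ := h1
  obtain ⟨x, hx⟩ := hSch.exists_aeval_exp_ne_zero hK hD0
  apply hx
  have h2 := hD _ ⟨i₀.insertNth (∑ j, (q j : ℝ) * x j) x, (hmq _).2 (by simp), rfl⟩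
  convert h2 using 2
  ext (_ | _) <;> simp [hvC, expGraph]

/-- Main theorem: assuming Schanuel's conjecture, if `Z(P) ⊆ ℝ^{2n}` is irreducible over `𝕂`
and `Z(E(P))` has dimension `n-1`, then either `Z(E(P))` is irreducible, or every
`(n-1)`-dimensional irreducible component of it is a rational hyperplane through the origin. -/
theorem stmt16 (hSch : SchanuelConjecture) (n : ℕ) (K : Subfield ℝ) (hK : RealAlgExt K)
    (P : MvPolynomial (Fin n ⊕ Fin n) ℝ) (hP : CoeffsIn K P)
    (hirr : IsIrredAlgSet K {z : Fin n ⊕ Fin n → ℝ | MvPolynomial.eval z P = 0})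
    (V : Set (Fin n → ℝ)) (hVdef : V = {x | expEval P x = 0})
    (hdim : dimH V = ((n - 1 : ℕ) : ℝ≥0∞)) :
    IsIrredExpSet K V ∨
    ∀ T : Set (Fin n → ℝ), IsExpComponent K T V → dimH T = ((n - 1 : ℕ) : ℝ≥0∞) →
      ∃ m : Fin n → ℤ, (∃ i, m i ≠ 0) ∧
        T = {x : Fin n → ℝ | ∑ i, (m i : ℝ) * x i = 0} := by
  by_cases hV : IsIrredExpSet K V
  · exact Or.inl hV
  refine Or.inr ?_
  rintro T ⟨hT, hTV, -⟩ hTdim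
  cases n with
  | zero =>
    refine absurd ⟨⟨P, hP, hVdef⟩, hT.2.1.mono hTV, ?_⟩ hV
    rintro ⟨V₁, V₂, -, -, hu, h1, h2⟩
    obtain ⟨x, hx⟩ := hT.2.1.mono hTV
    rcases hu ▸ hx with hx | hx
    · exact h1.2 fun y _ => Subsingleton.elim x y ▸ hx
    · exact h2.2 fun y _ => Subsingleton.elim x y ▸ hx
  | succ k =>
    rw [Nat.add_sub_cancel] at hdim hTdim
    obtain ⟨Q, rfl⟩ := coeffsIn_iff_exists_map.1 hP
    have hVQ : ∀ x, x ∈ V ↔ MvPolynomial.aeval (expGraph x) Q = 0 := by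
      intro x
      rw [hVdef, MvPolynomial.aeval_def, ← MvPolynomial.eval_map]
      rfl
    have hZQ : ∀ z, z ∈ {z | MvPolynomial.eval z (MvPolynomial.map (algebraMap K ℝ) Q) = 0} ↔
        MvPolynomial.aeval z Q = 0 := by
      intro z
      rw [MvPolynomial.aeval_def, ← MvPolynomial.eval_map]
      rfl
    have hprime := hirr.isPrime_vanishingIdeal
    have hQmem : Q ∈ MvPolynomial.vanishingIdeal K
        {z | MvPolynomial.eval z (MvPolynomial.map (algebraMap K ℝ) Q) = 0} :=
      fun z hz => (hZQ z).1 hz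
    refine hSch.eq_rational_hyperplane hK hT hTdim (I := MvPolynomial.vanishingIdeal K
      {z | MvPolynomial.eval z (MvPolynomial.map (algebraMap K ℝ) Q) = 0}) ?_ ?_
    · intro hbot
      have hQ0 : Q = 0 := Ideal.mem_bot.1 (hbot.le hQmem)
      have huniv : V = univ := eq_univ_of_forall fun x => by rw [hVQ, hQ0, map_zero]
      rw [huniv, Real.dimH_univ_pi_fin] at hdim
      have : k + 1 = k := by exact_mod_cast hdim
      omega
    · refine lt_of_le_of_ne (MvPolynomial.vanishingIdeal_anti_mono ?_) fun heq => hV ?_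
      · rintro _ ⟨x, hx, rfl⟩
        exact (hZQ _).2 ((hVQ x).1 (hTV hx))
      · obtain ⟨R, hR⟩ := isExpSet_iff.1 hT.1
        have hRmem : R ∈ MvPolynomial.vanishingIdeal K (expGraph '' T) := by
          rintro _ ⟨x, hx, rfl⟩
          rwa [hR] at hx
        rw [← heq] at hRmem
        have hVT : V ⊆ T := fun x hx => by
          rw [hR]
          exact hRmem _ ((hZQ _).2 ((hVQ x).1 hx))
        rwa [hVT.antisymm hTV]

end
end

section
/- Assume Schanuel's conjecture over the reals. Let P ∈ 𝕂[X₁,…,Xₙ,U₁,…,Uₙ] be such that Z(P) ⊆ ℝ^{2n} is an irreducible real algebraic set over 𝕂, let f = E(P) and V = Z(f) with dim V = n−1. Then every irreducible component T of V with dim T = n−1 either coincides with V, or there exist finitely many (possibly zero) hyperplanes H₁,…,H_k through the origin, each of the form {x ∈ ℝⁿ : m₁x₁+⋯+mₙxₙ = 0} with integers m₁,…,mₙ not all zero, such that H₁ ∪ ⋯ ∪ H_k ⊆ T and every point x ∈ T \ (H₁ ∪ ⋯ ∪ H_k) satisfies dim_x T < n−1. -/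
open MeasureTheory Set
open scoped ENNReal

noncomputable section

theorem AnalyticOnNhd.exists_iteratedFDeriv_ne_zero {E : Type*} [NormedAddCommGroup E]
    [NormedSpace ℝ E] {g : E → ℝ} {U : Set E} (hg : AnalyticOnNhd ℝ g U)
    (hU : IsPreconnected U) (hne : ∃ x ∈ U, g x ≠ 0) {x : E} (hx : x ∈ U) :
    ∃ k, iteratedFDeriv ℝ k g x ≠ 0 := by
  by_contra! h
  obtain ⟨x₁, hx₁, hgx₁⟩ := hne
  refine hgx₁ (hg.eqOn_zero_of_preconnected_of_eventuallyEq_zero hU hx ?_ hx₁)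
  obtain ⟨p, r, hp⟩ := hg x hx
  have hball : Metric.eball x r ∈ nhds x := Metric.eball_mem_nhds x hp.r_pos
  filter_upwards [hball] with y hy
  have hy' : y - x ∈ Metric.eball (0 : E) r := by
    simpa [edist_eq_enorm_sub] using hy
  have hs := hp.hasSum_iteratedFDeriv hy'
  simp only [h, zero_apply, smul_zero, add_sub_cancel] at hs
  exact hs.unique hasSum_zero

theorem ContinuousMultilinearMap.exists_ne_zero_on_basis {n k : ℕ}
    {M : ContinuousMultilinearMap ℝ (fun _ : Fin k => Fin n → ℝ) ℝ} (hM : M ≠ 0) :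
    ∃ c : Fin k → Fin n, M (fun i => Pi.single (c i) 1) ≠ 0 := by
  by_contra! h
  refine hM (ContinuousMultilinearMap.toMultilinearMap_injective ?_)
  refine Module.Basis.ext_multilinear (fun _ => Pi.basisFun ℝ (Fin n)) fun c => ?_
  simpa using h c

/-- Insertion of the `j`-th coordinate, as a continuous linear map. -/
def insertCLM {m : ℕ} (j : Fin (m + 1)) : (Fin m → ℝ) × ℝ →L[ℝ] (Fin (m + 1) → ℝ) :=
  ContinuousLinearMap.pi fun i =>
    j.insertNth (α := fun _ => (Fin m → ℝ) × ℝ →L[ℝ] ℝ) (ContinuousLinearMap.snd ℝ _ _)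
      (fun l => (ContinuousLinearMap.proj l).comp (ContinuousLinearMap.fst ℝ _ _)) i

theorem insertCLM_apply {m : ℕ} (j : Fin (m + 1)) (u : (Fin m → ℝ) × ℝ) :
    insertCLM j u = j.insertNth (α := fun _ => ℝ) u.2 u.1 := by
  ext i
  refine Fin.succAboveCases j ?_ (fun l => ?_) i <;> simp [insertCLM]

theorem insertCLM_single {m : ℕ} (j : Fin (m + 1)) (t : ℝ) :
    insertCLM j (0, t) = Pi.single j t := by
  rw [insertCLM_apply]
  ext i
  refine Fin.succAboveCases j ?_ (fun l => ?_) i <;> simp [Fin.succAbove_ne]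

theorem AnalyticAt.insertCLM_graph {m : ℕ} (j : Fin (m + 1)) {φ : (Fin m → ℝ) → ℝ}
    {y : Fin m → ℝ} (hφ : AnalyticAt ℝ φ y) :
    AnalyticAt ℝ (fun y => insertCLM j (y, φ y)) y :=
  ((insertCLM j).analyticAt _).comp (f := fun y => (y, φ y)) (analyticAt_id.prod hφ)

/-- An analytic function whose `j`-th partial derivative does not vanish at one of its zeros has
a zero set that is locally contained in the graph of an analytic function. -/
theorem AnalyticAt.exists_graph {m : ℕ} {h : (Fin (m + 1) → ℝ) → ℝ} {x : Fin (m + 1) → ℝ}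
    (hh : AnalyticAt ℝ h x) (hx : h x = 0) {j : Fin (m + 1)}
    (hj : fderiv ℝ h x (Pi.single j 1) ≠ 0) {U : Set (Fin (m + 1) → ℝ)} (hU : IsOpen U)
    (hxU : x ∈ U) :
    ∃ (y₀ : Fin m → ℝ) (r : ℝ) (φ : (Fin m → ℝ) → ℝ), 0 < r ∧
      AnalyticOnNhd ℝ φ (Metric.ball y₀ r) ∧
      (∀ y ∈ Metric.ball y₀ r, insertCLM j (y, φ y) ∈ U) ∧
      ∃ N ∈ nhds x, ∀ z ∈ N, h z = 0 →
        z ∈ (fun y => insertCLM j (y, φ y)) '' Metric.ball y₀ r := by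
  set u : (Fin m → ℝ) × ℝ := (fun i => x (j.succAbove i), x j) with hu
  have hux : insertCLM j u = x := by
    rw [insertCLM_apply]; exact Fin.insertNth_self_removeNth j x
  have hd : HasFDerivAt (h ∘ insertCLM j) ((fderiv ℝ h x).comp (insertCLM j)) u := by
    refine HasFDerivAt.comp u ?_ (insertCLM j).hasFDerivAt
    rw [hux]; exact hh.differentiableAt.hasFDerivAt
  have cdf : ContDiffAt ℝ ⊤ (h ∘ insertCLM j) u := by
    have hh' : AnalyticAt ℝ h (insertCLM j u) := by rwa [hux]
    exact (hh'.comp ((insertCLM j).analyticAt u)).contDiffAt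
  set a : ℝ := fderiv ℝ h x (Pi.single j 1) with ha
  have hinv : (fderiv ℝ (h ∘ insertCLM j) u ∘L .inr ℝ (Fin m → ℝ) ℝ).IsInvertible := by
    refine ⟨ContinuousLinearEquiv.unitsEquivAut ℝ (Units.mk0 a hj), ?_⟩
    ext
    rw [hd.fderiv]
    simp [insertCLM_single, ha]
  have htop : (⊤ : WithTop ℕ∞) ≠ 0 := by simp
  set φ := cdf.implicitFunction htop hinv with hφ
  have hφu : φ u.1 = u.2 := cdf.implicitFunction_apply_self htop hinv
  have hφa : AnalyticAt ℝ φ u.1 := (cdf.contDiffAt_implicitFunction htop hinv).analyticAt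
  have hgraph : AnalyticAt ℝ (fun y => insertCLM j (y, φ y)) u.1 :=
    hφa.insertCLM_graph j
  have hmem : ∀ᶠ y in nhds u.1, insertCLM j (y, φ y) ∈ U := by
    refine hgraph.continuousAt.eventually_mem (hU.mem_nhds ?_)
    have : (u.1, φ u.1) = u := by rw [hφu]
    rw [this, hux]; exact hxU
  obtain ⟨r, hr, hball⟩ := Metric.eventually_nhds_iff_ball.mp
    (hmem.and hφa.eventually_analyticAt)
  refine ⟨u.1, r, φ, hr, fun y hy => (hball y hy).2, fun y hy => (hball y hy).1, ?_⟩
  have hiff := cdf.eventually_apply_eq_iff_implicitFunction htop hinv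
  have hcont : Continuous fun z : Fin (m + 1) → ℝ => ((fun i => z (j.succAbove i)), z j) := by
    refine Continuous.prodMk ?_ (continuous_apply j)
    exact continuous_pi fun i => continuous_apply _
  have h1 := hcont.continuousAt (x := x) |>.eventually hiff
  have h2 : ∀ᶠ z in nhds x, (fun i => z (j.succAbove i)) ∈ Metric.ball u.1 r :=
    (continuous_fst.comp hcont).continuousAt.eventually_mem (Metric.ball_mem_nhds _ hr)
  refine ⟨_, h1.and h2, fun z hz hz0 => ⟨fun i => z (j.succAbove i), hz.2, ?_⟩⟩
  have hins : insertCLM j ((fun i => z (j.succAbove i)), z j) = z := by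
    rw [insertCLM_apply]; exact Fin.insertNth_self_removeNth j z
  have := hz.1
  simp only [Function.comp_apply, hins, hux] at this
  have h3 := this.1 (by rw [hz0, hx])
  change φ _ = z j at h3
  simp only [h3, hins]

/-- The zero set of a nonzero analytic function is covered by countably many analytic graphs. -/
theorem AnalyticOnNhd.zeros_subset_iUnion_graph {m : ℕ} {g : (Fin (m + 1) → ℝ) → ℝ}
    {U : Set (Fin (m + 1) → ℝ)} (hg : AnalyticOnNhd ℝ g U) (hUo : IsOpen U)
    (hU : IsPreconnected U) (hne : ∃ x ∈ U, g x ≠ 0) :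
    ∃ (ι : Type) (_ : Countable ι) (j : ι → Fin (m + 1)) (y₀ : ι → Fin m → ℝ) (r : ι → ℝ)
      (φ : ι → (Fin m → ℝ) → ℝ), (∀ i, 0 < r i) ∧
      (∀ i, AnalyticOnNhd ℝ (φ i) (Metric.ball (y₀ i) (r i))) ∧
      (∀ i, ∀ y ∈ Metric.ball (y₀ i) (r i), insertCLM (j i) (y, φ i y) ∈ U) ∧
      {x ∈ U | g x = 0} ⊆
        ⋃ i, (fun y => insertCLM (j i) (y, φ i y)) '' Metric.ball (y₀ i) (r i) := by
  let h : (Σ k : ℕ, Fin k → Fin (m + 1)) → (Fin (m + 1) → ℝ) → ℝ := fun c x =>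
    iteratedFDeriv ℝ c.1 g x (fun i => Pi.single (c.2 i) 1)
  let S : (Σ k : ℕ, Fin k → Fin (m + 1)) × Fin (m + 1) → Set (Fin (m + 1) → ℝ) := fun c =>
    {x ∈ U | h c.1 x = 0 ∧ fderiv ℝ (h c.1) x (Pi.single c.2 1) ≠ 0}
  have han : ∀ c, ∀ x ∈ U, AnalyticAt ℝ (h c) x := fun c x hx =>
    ((ContinuousMultilinearMap.apply ℝ (fun _ : Fin c.1 => (Fin (m + 1) → ℝ)) ℝ
      (fun i => Pi.single (c.2 i) 1)).analyticAt _).comp (hg.iteratedFDeriv c.1 x hx)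
  have hcover : {x ∈ U | g x = 0} ⊆ ⋃ c, S c := by
    rintro x ⟨hxU, hx0⟩
    have hex := hg.exists_iteratedFDeriv_ne_zero hU hne hxU
    classical
    obtain ⟨k, hk⟩ : ∃ k, Nat.find hex = k + 1 := by
      refine Nat.exists_eq_succ_of_ne_zero fun h0 => ?_
      have := Nat.find_spec hex
      rw [h0] at this
      refine this ?_
      ext v
      simpa using hx0
    have hne1 : iteratedFDeriv ℝ (k + 1) g x ≠ 0 := hk ▸ Nat.find_spec hex
    have hzero : iteratedFDeriv ℝ k g x = 0 := by
      by_contra h0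
      have := Nat.find_min' hex h0
      omega
    obtain ⟨c, hc⟩ := ContinuousMultilinearMap.exists_ne_zero_on_basis hne1
    refine mem_iUnion.2 ⟨(⟨k, fun i => c i.succ⟩, c 0), hxU, by simp [h, hzero], ?_⟩
    rw [iteratedFDeriv_succ_apply_left] at hc
    have hd : HasFDerivAt (h ⟨k, fun i => c i.succ⟩)
        ((ContinuousMultilinearMap.apply ℝ (fun _ : Fin k => (Fin (m + 1) → ℝ)) ℝ
          (fun i => Pi.single (c i.succ) 1)).comp (fderiv ℝ (iteratedFDeriv ℝ k g) x)) x :=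
      (ContinuousMultilinearMap.apply ℝ (fun _ : Fin k => (Fin (m + 1) → ℝ)) ℝ
        (fun i => Pi.single (c i.succ) 1)).hasFDerivAt.comp x
        (hg.iteratedFDeriv k x hxU).differentiableAt.hasFDerivAt
    rw [hd.fderiv]
    exact hc
  have hloc : ∀ c, ∀ x : S c, ∃ (y₀ : Fin m → ℝ) (r : ℝ) (φ : (Fin m → ℝ) → ℝ), 0 < r ∧
      AnalyticOnNhd ℝ φ (Metric.ball y₀ r) ∧
      (∀ y ∈ Metric.ball y₀ r, insertCLM c.2 (y, φ y) ∈ U) ∧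
      (fun y => insertCLM c.2 (y, φ y)) '' Metric.ball y₀ r ∈ nhdsWithin x.1 (S c) := by
    rintro c ⟨x, hxU, hx0, hx1⟩
    obtain ⟨y₀, r, φ, hr, hφ, hmem, N, hN, hNz⟩ :=
      (han c.1 x hxU).exists_graph hx0 hx1 hUo hxU
    refine ⟨y₀, r, φ, hr, hφ, hmem, ?_⟩
    filter_upwards [mem_nhdsWithin_of_mem_nhds hN, self_mem_nhdsWithin] with z hz hzS
    exact hNz z hz hzS.2.1
  choose y₀ r φ hr hφ hmem hnh using hloc
  have hct : ∀ c, ∃ t : Set (S c), t.Countable ∧ S c ⊆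
      ⋃ x ∈ t, (fun y => insertCLM c.2 (y, φ c x y)) '' Metric.ball (y₀ c x) (r c x) := by
    intro c
    classical
    obtain ⟨t, hts, htc, ht⟩ := TopologicalSpace.countable_cover_nhdsWithin
      (s := S c) (f := fun x => if hx : x ∈ S c then
        (fun y => insertCLM c.2 (y, φ c ⟨x, hx⟩ y)) '' Metric.ball (y₀ c ⟨x, hx⟩) (r c ⟨x, hx⟩)
        else ∅) (fun x hx => by simpa only [hx, dite_true] using hnh c ⟨x, hx⟩)
    refine ⟨Subtype.val ⁻¹' t, htc.preimage Subtype.val_injective, fun z hz => ?_⟩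
    obtain ⟨x, hxt, hzx⟩ := mem_iUnion₂.1 (ht hz)
    simp only [hts hxt, dite_true] at hzx
    exact mem_iUnion₂.2 ⟨⟨x, hts hxt⟩, hxt, hzx⟩
  choose t htc ht using hct
  have : ∀ c, Countable (t c) := fun c => (htc c).to_subtype
  refine ⟨Σ c, t c, inferInstance, fun i => i.1.2, fun i => y₀ i.1 i.2.1, fun i => r i.1 i.2.1,
    fun i => φ i.1 i.2.1, fun i => hr _ _, fun i => hφ _ _, fun i => hmem _ _, fun x hx => ?_⟩
  obtain ⟨c, hc⟩ := mem_iUnion.1 (hcover hx)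
  obtain ⟨z, hz, hxz⟩ := mem_iUnion₂.1 (ht c hc)
  exact mem_iUnion.2 ⟨⟨c, z, hz⟩, hxz⟩

theorem AnalyticOnNhd.dimH_graph_image_le {m : ℕ} {φ : (Fin m → ℝ) → ℝ} {y₀ : Fin m → ℝ} {r : ℝ}
    (hφ : AnalyticOnNhd ℝ φ (Metric.ball y₀ r)) (j : Fin (m + 1)) {s : Set (Fin m → ℝ)}
    (hs : s ⊆ Metric.ball y₀ r) :
    dimH ((fun y => insertCLM j (y, φ y)) '' s) ≤ dimH s := by
  refine ContDiffOn.dimH_image_le (s := Metric.ball y₀ r) ?_ (convex_ball y₀ r) hs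
  have : AnalyticOnNhd ℝ (fun y => insertCLM j (y, φ y)) (Metric.ball y₀ r) := fun y hy =>
    (hφ y hy).insertCLM_graph j
  exact this.contDiffOn Metric.isOpen_ball.uniqueDiffOn

/-- The zero set of a nonzero analytic function on `ℝᵐ` is empty or has dimension at most
`m - 1`. -/
theorem AnalyticOnNhd.zeros_eq_empty_or_dimH_add_one_le {m : ℕ} {g : (Fin m → ℝ) → ℝ}
    {U : Set (Fin m → ℝ)} (hg : AnalyticOnNhd ℝ g U) (hUo : IsOpen U) (hU : IsPreconnected U)
    (hne : ∃ x ∈ U, g x ≠ 0) :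
    {x ∈ U | g x = 0} = ∅ ∨ dimH {x ∈ U | g x = 0} + 1 ≤ (m : ℝ≥0∞) := by
  cases m with
  | zero =>
    left
    obtain ⟨x₁, -, hx₁⟩ := hne
    refine eq_empty_of_forall_notMem fun x hx => hx₁ ?_
    rw [Subsingleton.elim x₁ x]; exact hx.2
  | succ m =>
    right
    obtain ⟨ι, _, j, y₀, r, φ, -, hφ, -, hcov⟩ := hg.zeros_subset_iUnion_graph hUo hU hne
    push_cast
    gcongr
    refine (dimH_mono hcov).trans ?_
    rw [dimH_iUnion]
    refine iSup_le fun i => ((hφ i).dimH_graph_image_le (j i) subset_rfl).trans ?_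
    exact (dimH_mono (subset_univ _)).trans (Real.dimH_univ_pi_fin m).le

/-- Either the zero set of a nonzero analytic function on `ℝᵐ⁺¹` contains the graph of an analytic
function over a ball in `ℝᵐ`, or it is empty, or it has dimension at most `m - 1`. -/
theorem AnalyticOnNhd.exists_graph_subset_zeros_or {m : ℕ} {g : (Fin (m + 1) → ℝ) → ℝ}
    {U : Set (Fin (m + 1) → ℝ)} (hg : AnalyticOnNhd ℝ g U) (hUo : IsOpen U)
    (hU : IsPreconnected U) (hne : ∃ x ∈ U, g x ≠ 0) :
    (∃ (j : Fin (m + 1)) (y₀ : Fin m → ℝ) (r : ℝ) (φ : (Fin m → ℝ) → ℝ), 0 < r ∧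
      AnalyticOnNhd ℝ φ (Metric.ball y₀ r) ∧
      ∀ y ∈ Metric.ball y₀ r, insertCLM j (y, φ y) ∈ U ∧ g (insertCLM j (y, φ y)) = 0) ∨
    {x ∈ U | g x = 0} = ∅ ∨ dimH {x ∈ U | g x = 0} + 1 ≤ (m : ℝ≥0∞) := by
  rw [or_iff_not_imp_left]
  intro hno
  push Not at hno
  obtain ⟨ι, _, j, y₀, r, φ, hr, hφ, hmem, hcov⟩ := hg.zeros_subset_iUnion_graph hUo hU hne
  let Z : ι → Set (Fin m → ℝ) := fun i =>
    {y ∈ Metric.ball (y₀ i) (r i) | g (insertCLM (j i) (y, φ i y)) = 0}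
  have hZ : ∀ i, Z i = ∅ ∨ dimH (Z i) + 1 ≤ (m : ℝ≥0∞) := fun i => by
    refine AnalyticOnNhd.zeros_eq_empty_or_dimH_add_one_le
      (g := fun y => g (insertCLM (j i) (y, φ i y))) (fun y hy => ?_) Metric.isOpen_ball
      (convex_ball _ _).isPreconnected ?_
    · exact (hg _ (hmem i y hy)).comp (f := fun y => insertCLM (j i) (y, φ i y))
        ((hφ i y hy).insertCLM_graph (j i))
    · obtain ⟨y, hy, hy'⟩ := hno (j i) (y₀ i) (r i) (φ i) (hr i) (hφ i)
      exact ⟨y, hy, hy' (hmem i y hy)⟩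
  have hsub : {x ∈ U | g x = 0} ⊆ ⋃ i, (fun y => insertCLM (j i) (y, φ i y)) '' Z i := by
    intro x hx
    obtain ⟨i, y, hy, rfl⟩ := mem_iUnion.1 (hcov hx)
    exact mem_iUnion.2 ⟨i, y, ⟨hy, hx.2⟩, rfl⟩
  by_cases hall : ∀ i, Z i = ∅
  · left
    simpa [hall, subset_empty_iff] using hsub
  · right
    push Not at hall
    obtain ⟨i₀, hi₀⟩ := hall
    have h1 : (1 : ℝ≥0∞) ≤ m :=
      le_add_self.trans ((hZ i₀).resolve_left hi₀.ne_empty)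
    rw [← ENNReal.le_sub_iff_add_le_right (by simp) h1]
    refine (dimH_mono hsub).trans ?_
    rw [dimH_iUnion]
    refine iSup_le fun i =>
      ((hφ i).dimH_graph_image_le (j i) (fun y hy => hy.1)).trans ?_
    rcases hZ i with h | h
    · simp [h]
    · exact (ENNReal.le_sub_iff_add_le_right (by simp) h1).2 h

/-- If `p` is irreducible in `A[X]` and does not divide `q`, the ideal `(p, q)` contains a nonzero
constant. -/
theorem Polynomial.exists_C_eq_of_irreducible_of_not_dvd {A : Type*} [CommRing A] [IsDomain A]
    [UniqueFactorizationMonoid A] {p q : Polynomial A} (hp : Irreducible p) (hpq : ¬ p ∣ q) :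
    ∃ r : A, r ≠ 0 ∧ ∃ a b : Polynomial A, Polynomial.C r = a * p + b * q := by
  have := Classical.arbitrary (NormalizedGCDMonoid A)
  by_cases hdeg : p.natDegree = 0
  · obtain ⟨r, rfl⟩ := Polynomial.natDegree_eq_zero.1 hdeg
    exact ⟨r, fun h => hp.ne_zero (by simp [h]), 1, 0, by simp⟩
  let F := FractionRing A
  have hprim : p.IsPrimitive := hp.isPrimitive hdeg
  have hirr : Irreducible (p.map (algebraMap A F)) :=
    hprim.irreducible_iff_irreducible_map_fraction_map.1 hp
  have hnd : ¬ p.map (algebraMap A F) ∣ q.map (algebraMap A F) := fun h =>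
    hpq (hprim.dvd_of_fraction_map_dvd_fraction_map h)
  obtain ⟨a, b, hab⟩ := (hirr.coprime_iff_not_dvd.2 hnd)
  obtain ⟨c, c0, hc⟩ := IsLocalization.integerNormalization_spec (nonZeroDivisors A) a
  obtain ⟨d, d0, hd⟩ := IsLocalization.integerNormalization_spec (nonZeroDivisors A) b
  refine ⟨c * d, mul_ne_zero (nonZeroDivisors.ne_zero c0) (nonZeroDivisors.ne_zero d0),
    Polynomial.C d * IsLocalization.integerNormalization (nonZeroDivisors A) a,
    Polynomial.C c * IsLocalization.integerNormalization (nonZeroDivisors A) b, ?_⟩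
  apply Polynomial.map_injective (algebraMap A F) (IsFractionRing.injective A F)
  simp only [Polynomial.map_add, Polynomial.map_mul, hc, hd, Polynomial.map_C, map_mul,
    Algebra.smul_def, Polynomial.algebraMap_apply, IsScalarTower.algebraMap_apply A F (Polynomial F)]
  linear_combination (-Polynomial.C (algebraMap A F c) * Polynomial.C (algebraMap A F d)) * hab

/-- If `p` is irreducible and does not divide `q`, any variable can be eliminated from `p` and
`q`. -/
theorem MvPolynomial.exists_rename_eq_of_irreducible_of_not_dvd {σ K : Type*} [DecidableEq σ]
    [Field K] {p q : MvPolynomial σ K} (hp : Irreducible p) (hpq : ¬ p ∣ q) (v : σ) :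
    ∃ r : MvPolynomial {s // s ≠ v} K, r ≠ 0 ∧ ∃ a b : MvPolynomial σ K,
      rename Subtype.val r = a * p + b * q := by
  let e : MvPolynomial σ K ≃ₐ[K] Polynomial (MvPolynomial {s // s ≠ v} K) :=
    (renameEquiv K (Equiv.optionSubtypeNe v).symm).trans (optionEquivLeft K _)
  have hpe : Irreducible (e p) := (MulEquiv.irreducible_iff e).2 hp
  have hqe : ¬ e p ∣ e q := fun h => hpq ((map_dvd_iff e).1 h)
  obtain ⟨r, hr, a, b, hab⟩ := Polynomial.exists_C_eq_of_irreducible_of_not_dvd hpe hqe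
  refine ⟨r, hr, e.symm a, e.symm b, e.injective ?_⟩
  rw [map_add, map_mul, map_mul, e.apply_symm_apply, e.apply_symm_apply, ← hab]
  have : e.toAlgHom.comp (rename Subtype.val) =
      IsScalarTower.toAlgHom K (MvPolynomial {s // s ≠ v} K) _ := by
    refine algHom_ext fun s => ?_
    simp [e, Equiv.optionSubtypeNe_symm_of_ne s.2]
  exact DFunLike.congr_fun this r

theorem CoeffsIn.exists_map_eq {σ : Type*} {K : Subfield ℝ} {P : MvPolynomial σ ℝ}
    (hP : CoeffsIn K P) : ∃ p : MvPolynomial σ K, MvPolynomial.map (algebraMap K ℝ) p = P := by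
  refine MvPolynomial.mem_range_map_iff_coeffs_subset.2 fun c hc => ?_
  obtain ⟨m, rfl⟩ := MvPolynomial.mem_coeffs_iff.1 hc |>.imp fun _ h => h.2.symm
  exact ⟨⟨_, hP m⟩, rfl⟩

theorem coeffsIn_map {σ : Type*} {K : Subfield ℝ} (p : MvPolynomial σ K) :
    CoeffsIn K (MvPolynomial.map (algebraMap K ℝ) p) := fun m => by
  rw [MvPolynomial.coeff_map]
  exact (p.coeff m).2

theorem CoeffsIn.sq_add_sq {σ : Type*} {K : Subfield ℝ} {P Q : MvPolynomial σ ℝ}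
    (hP : CoeffsIn K P) (hQ : CoeffsIn K Q) : CoeffsIn K (P ^ 2 + Q ^ 2) := by
  obtain ⟨p, rfl⟩ := hP.exists_map_eq
  obtain ⟨q, rfl⟩ := hQ.exists_map_eq
  have := coeffsIn_map (p ^ 2 + q ^ 2)
  rwa [map_add, map_pow, map_pow] at this

/-- The ideal of polynomials over `K` vanishing on a set of real points. -/
def vanishIdeal {σ : Type*} (K : Subfield ℝ) (S : Set (σ → ℝ)) : Ideal (MvPolynomial σ K) :=
  ⨅ z ∈ S, RingHom.ker (MvPolynomial.aeval z : MvPolynomial σ K →ₐ[K] ℝ)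

theorem mem_vanishIdeal {σ : Type*} {K : Subfield ℝ} {S : Set (σ → ℝ)} {p : MvPolynomial σ K} :
    p ∈ vanishIdeal K S ↔ ∀ z ∈ S, MvPolynomial.aeval z p = 0 := by
  simp [vanishIdeal, Submodule.mem_iInf, RingHom.mem_ker]

theorem IsIrredAlgSet.isPrime_vanishIdeal {σ : Type*} {K : Subfield ℝ} {S : Set (σ → ℝ)}
    (hS : IsIrredAlgSet K S) : (vanishIdeal K S).IsPrime := by
  obtain ⟨⟨P, hP, hSP⟩, ⟨z₀, hz₀⟩, hirr⟩ := hS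
  refine ⟨fun htop => ?_, fun {p q} hpq => ?_⟩
  · have h1 := mem_vanishIdeal.1 ((Ideal.eq_top_iff_one _).1 htop) z₀ hz₀
    simp at h1
  · by_contra! h
    have key : ∀ f : MvPolynomial σ K, f ∉ vanishIdeal K S →
        IsAlgSet K (S ∩ {z | MvPolynomial.aeval z f = 0}) ∧
          S ∩ {z | MvPolynomial.aeval z f = 0} ⊂ S := by
      intro f hf
      refine ⟨⟨P ^ 2 + (MvPolynomial.map (algebraMap K ℝ) f) ^ 2,
        hP.sq_add_sq (coeffsIn_map f), ?_⟩, inter_subset_left, fun hsub => ?_⟩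
      · ext z
        simp only [hSP, mem_inter_iff, mem_ofPred_eq, map_add, map_pow, MvPolynomial.eval_map,
          MvPolynomial.aeval_def]
        rw [add_eq_zero_iff_of_nonneg (sq_nonneg _) (sq_nonneg _), sq_eq_zero_iff, sq_eq_zero_iff]
      · exact hf (mem_vanishIdeal.2 fun z hz => (hsub hz).2)
    obtain ⟨hp1, hp2⟩ := key p h.1
    obtain ⟨hq1, hq2⟩ := key q h.2
    refine hirr ⟨_, _, hp1, hq1, ?_, hp2, hq2⟩
    rw [← inter_union_distrib_left, eq_comm, inter_eq_left]
    intro z hz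
    have := mem_vanishIdeal.1 hpq z hz
    rw [map_mul, mul_eq_zero] at this
    exact this

/-- On a proper algebraic subset of an irreducible algebraic set `Z(P)`, any set of coordinates
omitting one variable satisfies a nontrivial polynomial relation over `K`. -/
theorem exists_relation_of_isIrredAlgSet {σ : Type*} {K : Subfield ℝ}
    {P Q : MvPolynomial σ ℝ} (hP : CoeffsIn K P) (hQ : CoeffsIn K Q)
    (hirr : IsIrredAlgSet K {z : σ → ℝ | MvPolynomial.eval z P = 0}) (hP0 : P ≠ 0)
    {z₀ : σ → ℝ} (hPz : MvPolynomial.eval z₀ P = 0) (hQz : MvPolynomial.eval z₀ Q ≠ 0) (v : σ) :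
    ∃ r : MvPolynomial {s // s ≠ v} K, r ≠ 0 ∧ ∀ z : σ → ℝ, MvPolynomial.eval z P = 0 →
      MvPolynomial.eval z Q = 0 → MvPolynomial.aeval (fun s : {s // s ≠ v} => z s) r = 0 := by
  classical
  obtain ⟨p, rfl⟩ := hP.exists_map_eq
  obtain ⟨q, rfl⟩ := hQ.exists_map_eq
  simp only [MvPolynomial.eval_map, ← MvPolynomial.aeval_def] at hirr hPz hQz ⊢
  have hprime := hirr.isPrime_vanishIdeal
  have hpmem : p ∈ vanishIdeal K {z : σ → ℝ | MvPolynomial.aeval z p = 0} :=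
    mem_vanishIdeal.2 fun z hz => hz
  have hp0 : p ≠ 0 := fun h => hP0 (by simp [h])
  obtain ⟨f, hf, hfp⟩ := hprime.exists_mem_prime_of_ne_bot
    (fun h => hp0 (by rwa [h, Ideal.mem_bot] at hpmem))
  rw [mem_vanishIdeal] at hf
  have hfq : ¬ f ∣ q := by
    rintro ⟨g, rfl⟩
    exact hQz (by rw [map_mul, hf z₀ hPz, zero_mul])
  obtain ⟨r, hr, a, b, hab⟩ :=
    MvPolynomial.exists_rename_eq_of_irreducible_of_not_dvd hfp.irreducible hfq v
  refine ⟨r, hr, fun z hz1 hz2 => ?_⟩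
  have := congrArg (MvPolynomial.aeval z) hab
  rw [MvPolynomial.aeval_rename, map_add, map_mul, map_mul, hf z hz1, hz2] at this
  simpa [Function.comp_def] using this

theorem SchanuelConjecture.algebraicIndependent_exp_s17 (hSch : SchanuelConjecture) {m : ℕ}
    {w : Fin m → ℝ} (hw : ∀ i, IsAlgebraic ℚ (w i)) (hli : LinearIndependent ℚ w) :
    AlgebraicIndependent ℚ (fun i => Real.exp (w i)) := by
  by_contra hne
  obtain ⟨a, ⟨i, hi⟩, ha⟩ := hSch m w <| by
    rintro ⟨v, hv, hvi⟩
    have hexp : ∀ i, ∃ k, Real.exp (w k) = v i := fun i => by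
      rcases hv i with ⟨k, hk⟩ | h
      · exact absurd (hk ▸ hw k) (hvi.transcendental i)
      · exact h
    choose c hc using hexp
    have hcinj : Function.Injective c := fun i k hik => hvi.injective <| by
      rw [← hc, ← hc, hik]
    let e : Fin m ≃ Fin m := Equiv.ofBijective c (Finite.injective_iff_bijective.1 hcinj)
    refine hne ((algebraicIndependent_equiv e).1 ?_)
    convert hvi using 1
    exact funext hc
  rw [Fintype.linearIndependent_iff] at hli
  refine hi ?_
  have := hli (fun i => (a i : ℚ)) (by simpa [Rat.smul_def] using ha) i
  exact_mod_cast this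

/-- A form of the Lindemann–Weierstrass theorem, deduced from Schanuel's conjecture. -/
theorem SchanuelConjecture.eq_zero_of_sum_mul_exp_eq_zero (hSch : SchanuelConjecture) {m : ℕ}
    {w : Fin m → ℝ} (hw : ∀ i, IsAlgebraic ℚ (w i)) (hli : LinearIndependent ℚ w)
    {ι : Type*} {s : Finset ι} {c : ι → Fin m → ℤ} (hc : Set.InjOn c s) {q : ι → ℝ}
    (hq : ∀ d, IsAlgebraic ℚ (q d))
    (hsum : ∑ d ∈ s, q d * Real.exp (∑ k, (c d k : ℝ) * w k) = 0) : ∀ d ∈ s, q d = 0 := by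
  classical
  have hind := (hSch.algebraicIndependent_exp_s17 hw hli).subalgebraAlgebraicClosure
  let M : ℕ := ∑ d ∈ s, ∑ k, (c d k).natAbs
  have hM : ∀ d ∈ s, ∀ k, 0 ≤ c d k + M := fun d hd k => by
    have h1 : (c d k).natAbs ≤ ∑ k, (c d k).natAbs :=
      Finset.single_le_sum (f := fun k => (c d k).natAbs) (fun _ _ => Nat.zero_le _)
        (Finset.mem_univ k)
    have h2 : ∑ k, (c d k).natAbs ≤ M :=
      Finset.single_le_sum (f := fun d => ∑ k, (c d k).natAbs) (fun _ _ => Nat.zero_le _) hd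
    omega
  let N : ι → Fin m →₀ ℕ := fun d => Finsupp.equivFunOnFinite.symm fun k => (c d k + M).toNat
  have hN : ∀ d ∈ s, ∀ k, ((N d k : ℕ) : ℝ) = (c d k : ℝ) + M := fun d hd k => by
    have : ((N d k : ℕ) : ℤ) = c d k + M := Int.toNat_of_nonneg (hM d hd k)
    exact_mod_cast this
  have hNinj : Set.InjOn N s := fun d hd e he hde => hc hd he <| funext fun k => by
    have h1 : ((N d k : ℕ) : ℤ) = c d k + M := Int.toNat_of_nonneg (hM d hd k)
    have h2 : ((N e k : ℕ) : ℤ) = c e k + M := Int.toNat_of_nonneg (hM e he k)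
    rw [hde] at h1
    omega
  let qA : ι → Subalgebra.algebraicClosure ℚ ℝ := fun d => ⟨q d, hq d⟩
  let F : MvPolynomial (Fin m) (Subalgebra.algebraicClosure ℚ ℝ) :=
    ∑ d ∈ s, MvPolynomial.monomial (N d) (qA d)
  have hF : MvPolynomial.aeval (fun i => Real.exp (w i)) F = 0 := by
    have : ∀ d ∈ s, MvPolynomial.aeval (fun i => Real.exp (w i))
        (MvPolynomial.monomial (N d) (qA d)) =
        q d * Real.exp (∑ k, (c d k : ℝ) * w k) * Real.exp (∑ k, (M : ℝ) * w k) := by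
      intro d hd
      rw [MvPolynomial.aeval_monomial, mul_assoc, ← Real.exp_add, ← Finset.sum_add_distrib,
        Real.exp_sum, Finsupp.prod_fintype _ _ (by simp)]
      congr 1
      refine Finset.prod_congr rfl fun k _ => ?_
      rw [← Real.exp_nat_mul, hN d hd, add_mul]
    rw [map_sum, Finset.sum_congr rfl this, ← Finset.sum_mul, hsum, zero_mul]
  have hF0 : F = 0 := (map_eq_zero_iff _ hind).1 hF
  intro d hd
  have := congrArg (MvPolynomial.coeff (N d)) hF0
  rw [MvPolynomial.coeff_sum, Finset.sum_eq_single d, MvPolynomial.coeff_monomial, if_pos rfl,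
    MvPolynomial.coeff_zero] at this
  · exact congrArg Subtype.val this
  · intro e he hed
    rw [MvPolynomial.coeff_monomial, if_neg fun h => hed (hNinj he hd h)]
  · exact fun h => absurd hd h

/-- At a point `x` outside `WP Q` whose coordinates are integral combinations of linearly
independent algebraic numbers, `expEval Q x = 0` forces `Q` to vanish on `{x} × ℝⁿ`. -/
theorem SchanuelConjecture.eval_eq_zero_of_notMem_WP (hSch : SchanuelConjecture) {n m : ℕ}
    {K : Subfield ℝ} (hK : RealAlgExt K) {Q : MvPolynomial (Fin n ⊕ Fin n) ℝ} (hQ : CoeffsIn K Q)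
    {w : Fin m → ℝ} (hw : ∀ i, IsAlgebraic ℚ (w i)) (hli : LinearIndependent ℚ w)
    {x : Fin n → ℝ} {c : Fin n → Fin m → ℤ} (hx : ∀ i, x i = ∑ k, (c i k : ℝ) * w k)
    (hzero : expEval Q x = 0) (hWP : x ∉ WP Q) (u : Fin n → ℝ) :
    MvPolynomial.eval (Sum.elim x u) Q = 0 := by
  classical
  let D : Finset (Fin n → ℕ) := Q.support.image fun μ i => μ (Sum.inr i)
  let q : (Fin n → ℕ) → ℝ := fun d =>
    ∑ μ ∈ Q.support with (fun i => μ (Sum.inr i)) = d, Q.coeff μ * ∏ i, x i ^ μ (Sum.inl i)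
  have heval : ∀ u : Fin n → ℝ, MvPolynomial.eval (Sum.elim x u) Q =
      ∑ d ∈ D, q d * ∏ i, u i ^ d i := by
    intro u
    rw [MvPolynomial.eval_eq', ← Finset.sum_fiberwise_of_maps_to
      (t := D) (g := fun μ i => μ (Sum.inr i)) (fun μ hμ => Finset.mem_image_of_mem _ hμ)]
    refine Finset.sum_congr rfl fun d _ => ?_
    rw [Finset.sum_mul]
    refine Finset.sum_congr rfl fun μ hμ => ?_
    rw [← (Finset.mem_filter.1 hμ).2, Fintype.prod_sum_type, mul_assoc]
    simp
  have hxalg : ∀ i, IsAlgebraic ℚ (x i) := fun i => by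
    rw [hx]
    exact (Subalgebra.algebraicClosure ℚ ℝ).sum_mem fun k _ => (isAlgebraic_intCast _).mul (hw k)
  have hqalg : ∀ d, IsAlgebraic ℚ (q d) := fun d =>
    (Subalgebra.algebraicClosure ℚ ℝ).sum_mem fun μ _ => (hK ⟨_, hQ μ⟩).mul
      ((Subalgebra.algebraicClosure ℚ ℝ).prod_mem fun i _ => (hxalg i).pow _)
  have hlin : ∀ d : Fin n → ℕ, ∑ k, ((∑ i, (d i : ℤ) * c i k : ℤ) : ℝ) * w k =
      ∑ i, (d i : ℝ) * x i := fun d => by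
    simp only [hx, Int.cast_sum, Int.cast_mul, Int.cast_natCast, Finset.sum_mul, Finset.mul_sum,
      mul_assoc]
    exact Finset.sum_comm
  have hq0 := hSch.eq_zero_of_sum_mul_exp_eq_zero hw hli (s := D)
    (c := fun d k => ∑ i, (d i : ℤ) * c i k) (fun d hd e he hde => ?_) hqalg ?_
  · rw [heval]
    exact Finset.sum_eq_zero fun d hd => by rw [hq0 d hd, zero_mul]
  · by_contra hne
    refine hWP ⟨d, e, ?_, ?_, hne, ?_⟩
    · simpa [D, Uexps] using hd
    · simpa [D, Uexps] using he
    · rw [← hlin, ← hlin]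
      refine Finset.sum_congr rfl fun k _ => ?_
      have h : (∑ i, (d i : ℤ) * c i k) = ∑ i, (e i : ℤ) * c i k := congrFun hde k
      rw [h]
  · rw [← hzero, expEval, heval]
    refine Finset.sum_congr rfl fun d _ => ?_
    rw [hlin, Real.exp_sum]
    simp [Real.exp_nat_mul]

/-- If the coordinates of `x` other than the `j`-th are algebraic and, over them, all the
families obtained by omitting one of `x j, exp (x 0), …, exp (x m)` are algebraically dependent,
then the transcendence degree of `x, exp x` is less than `m + 1`. -/
theorem not_exists_algebraicIndependent_of_relations {m : ℕ} {K : Subfield ℝ} (hK : RealAlgExt K)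
    {x : Fin (m + 1) → ℝ} {j : Fin (m + 1)} (hx : ∀ i, i ≠ j → IsAlgebraic ℚ (x i))
    {z : Fin (m + 1) ⊕ Fin (m + 1) → ℝ} (hz : ∀ i, i ≠ j → z (Sum.inl i) = x i)
    (hrel : ∀ v, (∀ i, i ≠ j → v ≠ Sum.inl i) →
      ∃ r : MvPolynomial {s // s ≠ v} K, MvPolynomial.aeval (fun s : {s // s ≠ v} => z s) r ≠ 0 ∧
        MvPolynomial.aeval (fun s : {s // s ≠ v} =>
          (Sum.elim x fun i => Real.exp (x i) : Fin (m + 1) ⊕ Fin (m + 1) → ℝ) s.1) r = 0) :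
    ¬ ∃ v : Fin (m + 1) → ℝ,
        (∀ i, v i ∈ Set.range x ∪ Set.range fun j => Real.exp (x j)) ∧
        AlgebraicIndependent ℚ v := by
  classical
  rintro ⟨v, hv, hvi⟩
  set X : Fin (m + 1) ⊕ Fin (m + 1) → ℝ := Sum.elim x fun i => Real.exp (x i) with hX
  have hc : ∀ k, ∃ s, X s = v k := fun k => by
    rcases hv k with ⟨i, hi⟩ | ⟨i, hi⟩
    exacts [⟨Sum.inl i, hi⟩, ⟨Sum.inr i, hi⟩]
  choose c hc using hc
  have hcinj : Function.Injective c := fun i k hik => hvi.injective (by rw [← hc, ← hc, hik])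
  have hcne : ∀ k i, i ≠ j → c k ≠ Sum.inl i := fun k i hij hki => by
    refine hvi.transcendental k ?_
    rw [← hc, hki]
    exact hx i hij
  let J : Finset (Fin (m + 1) ⊕ Fin (m + 1)) := insert (Sum.inl j) (Finset.univ.image Sum.inr)
  have hJ : ∀ s, s ∈ J ↔ ∀ i, i ≠ j → s ≠ Sum.inl i := by
    rintro (i | i)
    · simp only [J, Finset.mem_insert, Sum.inl.injEq, Finset.mem_image, Finset.mem_univ, true_and,
        reduceCtorEq, exists_false, or_false]
      exact ⟨fun h k hk hik => hk ((Sum.inl.inj hik).symm.trans h),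
        fun h => by_contra fun h' => h i h' rfl⟩
    · simp [J]
  have hJcard : J.card = m + 2 := by
    rw [Finset.card_insert_of_notMem (by simp), Finset.card_image_of_injective _ Sum.inr_injective]
    simp
  have himg : (Finset.univ.image c).card = m + 1 := by
    rw [Finset.card_image_of_injective _ hcinj]; simp
  have hsub : Finset.univ.image c ⊆ J := fun s hs => by
    obtain ⟨k, -, rfl⟩ := Finset.mem_image.1 hs
    exact (hJ _).2 (hcne k)
  obtain ⟨v₀, hv₀⟩ : ∃ v₀, J \ Finset.univ.image c = {v₀} := by
    rw [← Finset.card_eq_one, Finset.card_sdiff_of_subset hsub, hJcard, himg]; omega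
  have hv₀mem : v₀ ∈ J \ Finset.univ.image c := by rw [hv₀]; exact Finset.mem_singleton_self _
  obtain ⟨r, hrz, hrx⟩ := hrel v₀ ((hJ v₀).1 (Finset.mem_sdiff.1 hv₀mem).1)
  have hcases : ∀ s : {s // s ≠ v₀}, (∃ k, c k = s) ∨ ∃ i, i ≠ j ∧ s.1 = Sum.inl i := by
    rintro ⟨s, hs⟩
    by_cases h : s ∈ J
    · left
      have : s ∉ J \ Finset.univ.image c := by rw [hv₀]; simpa using hs
      simpa [h] using this
    · right
      rw [hJ] at h
      push Not at h
      exact h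
  have hind := hvi.subalgebraAlgebraicClosure
  let A := Subalgebra.algebraicClosure ℚ ℝ
  let κ : K →+* A := (algebraMap K ℝ).codRestrict A fun a => hK a
  have hθ : ∀ s : {s // s ≠ v₀}, ∃ θ : MvPolynomial (Fin (m + 1)) A,
      MvPolynomial.aeval v θ = X s ∧ MvPolynomial.aeval (fun k => z (c k)) θ = z s := by
    intro s
    rcases hcases s with ⟨k, hk⟩ | ⟨i, hij, hs⟩
    · exact ⟨MvPolynomial.X k, by simp [← hk, hc], by simp [hk]⟩
    · refine ⟨MvPolynomial.C ⟨x i, hx i hij⟩, ?_, ?_⟩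
      · rw [MvPolynomial.aeval_C, hs]; rfl
      · rw [MvPolynomial.aeval_C, hs, hz i hij]; rfl
  choose θ hθ1 hθ2 using hθ
  let R : MvPolynomial (Fin (m + 1)) A := MvPolynomial.eval₂ (MvPolynomial.C.comp κ) θ r
  have hR : ∀ y : Fin (m + 1) → ℝ, MvPolynomial.aeval y R =
      MvPolynomial.aeval (fun s => MvPolynomial.aeval y (θ s)) r := by
    intro y
    have := MvPolynomial.eval₂_comp_left
      (MvPolynomial.aeval y : MvPolynomial (Fin (m + 1)) A →ₐ[A] ℝ).toRingHom
      (MvPolynomial.C.comp κ) θ r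
    refine this.trans ?_
    rw [MvPolynomial.aeval_def]
    congr 1
    ext a
    simp only [RingHom.comp_apply, AlgHom.toRingHom_eq_coe, RingHom.coe_coe, MvPolynomial.aeval_C]
    rfl
  have hR0 : R = 0 := by
    refine (map_eq_zero_iff _ hind).1 ?_
    rw [hR]
    simpa only [hθ1] using hrx
  refine hrz ?_
  have := hR fun k => z (c k)
  rw [hR0, map_zero] at this
  simpa only [hθ2] using this.symm

theorem exists_isAlgebraic_linearIndependent (m : ℕ) :
    ∃ β : Fin m → ℝ, (∀ i, IsAlgebraic ℚ (β i)) ∧ LinearIndependent ℚ β := by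
  obtain ⟨p, hmp, hp⟩ := Nat.exists_infinite_primes m
  have hp0 : (p : ℝ) ≠ 0 := Nat.cast_ne_zero.2 hp.ne_zero
  let α : ℝ := (2 : ℝ) ^ ((p : ℝ)⁻¹)
  have hα : α ^ p = 2 := by
    rw [← Real.rpow_natCast, ← Real.rpow_mul (by norm_num), inv_mul_cancel₀ hp0, Real.rpow_one]
  have hirr : Irreducible (Polynomial.X ^ p - Polynomial.C (2 : ℚ)) := by
    refine X_pow_sub_C_irreducible_of_prime hp fun b hb => hp.one_lt.ne' ?_
    have hb0 : b ≠ 0 := by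
      rintro rfl
      rw [zero_pow hp.ne_zero] at hb
      norm_num at hb
    have h1 := padicValRat.pow (p := 2) b (k := p)
    have h2 : padicValRat 2 (2 : ℚ) = 1 := padicValRat.self (p := 2) one_lt_two
    rw [hb, h2] at h1
    exact_mod_cast Int.eq_one_of_mul_eq_one_right (Int.natCast_nonneg p) h1.symm
  have hmin : minpoly ℚ α = Polynomial.X ^ p - Polynomial.C (2 : ℚ) :=
    (minpoly.eq_of_irreducible_of_monic hirr (by simp [hα])
      (Polynomial.monic_X_pow_sub_C _ hp.ne_zero)).symm
  have hdeg : (minpoly ℚ α).natDegree = p := by rw [hmin, Polynomial.natDegree_X_pow_sub_C]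
  have hαalg : IsAlgebraic ℚ α :=
    ⟨_, hirr.ne_zero, by simp [hα]⟩
  refine ⟨fun i => α ^ (i : ℕ), fun i => hαalg.pow _, ?_⟩
  exact (linearIndependent_pow (K := ℚ) α).comp (Fin.castLE (hmp.trans_eq hdeg.symm))
    (Fin.castLE_injective _)

theorem infinite_rat_mul_inter_ball {b y δ : ℝ} (hb : b ≠ 0) (hδ : 0 < δ) :
    {t : ℝ | (∃ q : ℚ, q ≠ 0 ∧ t = q * b) ∧ t ∈ Metric.ball y δ}.Infinite := by
  intro hfin
  have hopen : IsOpen (Metric.ball y δ \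
      ({t : ℝ | (∃ q : ℚ, q ≠ 0 ∧ t = q * b) ∧ t ∈ Metric.ball y δ} ∪ {0})) :=
    Metric.isOpen_ball.sdiff (hfin.union (finite_singleton 0)).isClosed
  have hne : (Metric.ball y δ \
      ({t : ℝ | (∃ q : ℚ, q ≠ 0 ∧ t = q * b) ∧ t ∈ Metric.ball y δ} ∪ {0})).Nonempty :=
    ((infinite_of_mem_nhds y (Metric.ball_mem_nhds y hδ)).sdiff
      (hfin.union (finite_singleton 0))).nonempty
  obtain ⟨t, ht⟩ := hne
  obtain ⟨q, hq⟩ := Rat.denseRange_cast.exists_mem_open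
    (hopen.preimage (continuous_mul_const b)) ⟨t / b, by simpa [div_mul_cancel₀ t hb] using ht⟩
  refine hq.2 (Or.inl ⟨⟨q, ?_, rfl⟩, hq.1⟩)
  rintro rfl
  exact hq.2 (Or.inr (by simp))

/-- A polynomial nonvanishing condition can be met with prescribed coordinates in the dense sets
of nonzero rational multiples of given numbers. -/
theorem exists_rat_mul_eval_ne_zero {σ : Type*} {m : ℕ} {c : Fin m → σ}
    (hc : Function.Injective c) {β : Fin m → ℝ} (hβ : ∀ k, β k ≠ 0) {F : MvPolynomial σ ℝ}
    (hF : F ≠ 0) (y : Fin m → ℝ) {δ : ℝ} (hδ : 0 < δ) :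
    ∃ z : σ → ℝ, (∀ k, ∃ q : ℚ, q ≠ 0 ∧ z (c k) = q * β k) ∧
      (fun k => z (c k)) ∈ Metric.ball y δ ∧ MvPolynomial.eval z F ≠ 0 := by
  by_contra! h
  let S : σ → Set ℝ := fun s =>
    {t | ∀ k, c k = s → (∃ q : ℚ, q ≠ 0 ∧ t = q * β k) ∧ t ∈ Metric.ball (y k) δ}
  have hS : ∀ s, (S s).Infinite := fun s => by
    by_cases hs : ∃ k, c k = s
    · obtain ⟨k, rfl⟩ := hs
      refine (infinite_rat_mul_inter_ball (hβ k) hδ (y := y k)).mono fun t ht k' hk' => ?_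
      rw [hc hk']
      exact ht
    · have : S s = univ := eq_univ_of_forall fun t k hk => absurd ⟨k, hk⟩ hs
      rw [this]
      exact infinite_univ
  refine hF (MvPolynomial.funext_set S hS fun z hz => ?_)
  rw [map_zero]
  refine h z (fun k => (hz (c k) (mem_univ _) k rfl).1) ?_
  rw [Metric.mem_ball, dist_pi_lt_iff hδ]
  exact fun k => (hz (c k) (mem_univ _) k rfl).2

/-- Schanuel's conjecture forces suitable zeros of an E-polynomial satisfying many polynomial
relations to lie in `WP Q`. -/
theorem SchanuelConjecture.mem_WP_of_relations (hSch : SchanuelConjecture) {m : ℕ}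
    {K : Subfield ℝ} (hK : RealAlgExt K) {Q : MvPolynomial (Fin (m + 1) ⊕ Fin (m + 1)) ℝ}
    (hQ : CoeffsIn K Q) {β : Fin m → ℝ} (hβ : ∀ i, IsAlgebraic ℚ (β i))
    (hli : LinearIndependent ℚ β) {x : Fin (m + 1) → ℝ} {j : Fin (m + 1)}
    (hx : ∀ k, ∃ q : ℚ, q ≠ 0 ∧ x (j.succAbove k) = q * β k) (hzero : expEval Q x = 0)
    {r : ∀ v, MvPolynomial {s : Fin (m + 1) ⊕ Fin (m + 1) // s ≠ v} K}
    (hr : ∀ v z, MvPolynomial.eval z Q = 0 →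
      MvPolynomial.aeval (fun s : {s // s ≠ v} => z s) (r v) = 0)
    {z : Fin (m + 1) ⊕ Fin (m + 1) → ℝ} (hz : ∀ i, i ≠ j → z (Sum.inl i) = x i)
    (hrz : ∀ v, MvPolynomial.aeval (fun s : {s // s ≠ v} => z s) (r v) ≠ 0) : x ∈ WP Q := by
  by_contra hWP
  choose q hq0 hq using hx
  obtain ⟨a, ha0, ha⟩ := hSch _ x (not_exists_algebraicIndependent_of_relations hK
    (fun i hij => by
      obtain ⟨k, rfl⟩ := Fin.exists_succAbove_eq hij
      rw [hq]
      exact (isAlgebraic_algebraMap (q k)).mul (hβ k))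
    hz fun v _ => ⟨r v, hrz v, hr v _ hzero⟩)
  rw [Fin.sum_univ_succAbove _ j] at ha
  have haj : a j ≠ 0 := by
    intro haj
    obtain ⟨i, hi⟩ := ha0
    have hij : i ≠ j := fun h => hi (h ▸ haj)
    obtain ⟨k, rfl⟩ := Fin.exists_succAbove_eq hij
    rw [haj, Int.cast_zero, zero_mul, zero_add] at ha
    have := Fintype.linearIndependent_iff.1 hli (fun k => a (j.succAbove k) * q k)
      (by
        rw [← ha]
        refine Finset.sum_congr rfl fun k _ => ?_
        rw [hq, Rat.smul_def]
        push_cast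
        ring) k
    rcases mul_eq_zero.1 this with h | h
    · exact hi (by exact_mod_cast h)
    · exact hq0 k h
  have haj' : (a j : ℝ) ≠ 0 := Int.cast_ne_zero.2 haj
  let u : Fin m → ℚˣ := fun k =>
    Units.mk0 (q k / a j) (div_ne_zero (hq0 k) (Int.cast_ne_zero.2 haj))
  let w : Fin m → ℝ := u • β
  have hwk : ∀ k, w k = ((q k / a j : ℚ) : ℝ) * β k := fun k => Rat.smul_def _ _
  have hxw : ∀ k, x (j.succAbove k) = a j * w k := fun k => by
    rw [hq, hwk]
    push_cast
    field_simp
  have hWli : LinearIndependent ℚ w := hli.units_smul u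
  have hwalg : ∀ k, IsAlgebraic ℚ (w k) := fun k => by
    rw [hwk]
    exact (isAlgebraic_algebraMap (_ : ℚ)).mul (hβ k)
  let c : Fin (m + 1) → Fin m → ℤ := j.insertNth (α := fun _ => Fin m → ℤ)
    (fun k => - a (j.succAbove k)) (fun l k => if l = k then a j else 0)
  have hxc : ∀ i, x i = ∑ k, (c i k : ℝ) * w k := by
    refine Fin.succAboveCases j ?_ fun l => ?_
    · simp only [c, Fin.insertNth_apply_same]
      refine mul_left_cancel₀ haj' ?_
      simp only [hxw] at ha
      rw [eq_neg_of_add_eq_zero_left ha, ← Finset.sum_neg_distrib, Finset.mul_sum]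
      refine Finset.sum_congr rfl fun k _ => ?_
      push_cast
      ring
    · simp only [c, Fin.insertNth_apply_succAbove]
      rw [Finset.sum_eq_single l, if_pos rfl, hxw]
      · intro k _ hk
        rw [if_neg hk.symm]; simp
      · exact fun h => absurd (Finset.mem_univ _) h
  have hvan := hSch.eval_eq_zero_of_notMem_WP hK hQ hwalg hWli hxc hzero hWP
    (fun i => z (Sum.inr i))
  refine hrz (Sum.inl j) ?_
  rw [← hr (Sum.inl j) _ hvan]
  congr 2
  funext ⟨s, hs⟩
  rcases s with i | i
  · exact hz i fun h => hs (h ▸ rfl)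
  · rfl

/-- If a finite product of analytic functions vanishes on a preconnected open set, so does one of
the factors. -/
theorem AnalyticOnNhd.exists_eqOn_zero_of_prod_eqOn_zero {E ι : Type*} [NormedAddCommGroup E]
    [NormedSpace ℝ E] {U : Set E} (hUo : IsOpen U) (hU : IsPreconnected U) (hUne : U.Nonempty)
    {f : ι → E → ℝ} (hf : ∀ i, AnalyticOnNhd ℝ (f i) U) (s : Finset ι)
    (h : ∀ y ∈ U, ∏ i ∈ s, f i y = 0) : ∃ i ∈ s, ∀ y ∈ U, f i y = 0 := by
  classical
  induction s using Finset.induction_on with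
  | empty =>
    obtain ⟨y, hy⟩ := hUne
    simpa using h y hy
  | insert a s ha ih =>
    by_cases hfa : ∀ y ∈ U, f a y = 0
    · exact ⟨a, Finset.mem_insert_self _ _, hfa⟩
    · push Not at hfa
      obtain ⟨y, hy, hya⟩ := hfa
      have hprod : AnalyticOnNhd ℝ (fun y => ∏ i ∈ s, f i y) U :=
        s.analyticOnNhd_fun_prod fun i _ => hf i
      obtain ⟨i, hi, hi0⟩ := ih <| hprod.eqOn_zero_of_preconnected_of_eventuallyEq_zero hU hy <| by
        filter_upwards [(hf a y hy).continuousAt.eventually_ne hya, hUo.mem_nhds hy] with w hw hwU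
        have := h w hwU
        rw [Finset.prod_insert ha] at this
        exact (mul_eq_zero.1 this).resolve_left hw
      exact ⟨i, Finset.mem_insert_of_mem hi, hi0⟩

/-- If the graph of an analytic function is contained in the zero set of an analytic function `g`
and meets a finite union of hyperplanes in a dense set, then one of these hyperplanes is contained
in the zero set of `g` and contains the graph. -/
theorem AnalyticOnNhd.exists_hyperplane_subset_zeros {m : ℕ} {g : (Fin (m + 1) → ℝ) → ℝ}
    (hg : AnalyticOnNhd ℝ g univ) {j : Fin (m + 1)} {y₀ : Fin m → ℝ} {r : ℝ} (hr : 0 < r)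
    {φ : (Fin m → ℝ) → ℝ} (hφ : AnalyticOnNhd ℝ φ (Metric.ball y₀ r))
    (hzero : ∀ y ∈ Metric.ball y₀ r, g (insertCLM j (y, φ y)) = 0)
    {ι : Type*} (s : Finset ι) {c : ι → Fin (m + 1) → ℝ} (hc : ∀ i ∈ s, c i ≠ 0)
    (hdense : ∀ y ∈ Metric.ball y₀ r, ∀ δ > 0, ∃ y' ∈ Metric.ball y δ, y' ∈ Metric.ball y₀ r ∧
      ∃ i ∈ s, ∑ l, c i l * insertCLM j (y', φ y') l = 0) :
    ∃ i ∈ s, (∀ y ∈ Metric.ball y₀ r, ∑ l, c i l * insertCLM j (y, φ y) l = 0) ∧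
      ∀ x, ∑ l, c i l * x l = 0 → g x = 0 := by
  have hψ : ∀ i, AnalyticOnNhd ℝ (fun y => ∑ l, c i l * insertCLM j (y, φ y) l)
      (Metric.ball y₀ r) := fun i =>
    Finset.analyticOnNhd_fun_sum _ fun l _ y hy => analyticAt_const.mul
      (analyticAt_pi_iff.1 ((hφ y hy).insertCLM_graph j) l)
  have hpre : IsPreconnected (Metric.ball y₀ r) := (convex_ball y₀ r).isPreconnected
  obtain ⟨i, hi, hi0⟩ := AnalyticOnNhd.exists_eqOn_zero_of_prod_eqOn_zero Metric.isOpen_ball hpre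
    ⟨y₀, Metric.mem_ball_self hr⟩ hψ s fun y hy => by
      by_contra hne
      have hcont : ContinuousAt (fun y => ∏ i ∈ s, ∑ l, c i l * insertCLM j (y, φ y) l) y :=
        ((s.analyticOnNhd_fun_prod fun i _ => hψ i) y hy).continuousAt
      obtain ⟨δ, hδ, hball⟩ := Metric.eventually_nhds_iff_ball.1 (hcont.eventually_ne hne)
      obtain ⟨y', hy', -, i, hi, hi0⟩ := hdense y hy δ hδ
      exact hball y' hy' (Finset.prod_eq_zero hi hi0)
  refine ⟨i, hi, hi0, fun x hx => ?_⟩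
  have hsum : ∀ u : (Fin m → ℝ) × ℝ, ∑ l, c i l * insertCLM j u l =
      c i j * u.2 + ∑ k, c i (j.succAbove k) * u.1 k := fun u => by
    rw [Fin.sum_univ_succAbove _ j, insertCLM_apply]
    simp
  have hcj : c i j ≠ 0 := by
    intro hcj
    refine hc i hi (funext <| Fin.succAboveCases j hcj fun k => ?_)
    have hlin : ∀ y ∈ Metric.ball y₀ r, ∑ k, c i (j.succAbove k) * y k = 0 := fun y hy => by
      have := hi0 y hy
      rwa [hsum, hcj, zero_mul, zero_add] at this
    have h0 := hlin y₀ (Metric.mem_ball_self hr)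
    have h1 := hlin (y₀ + Pi.single k (r / 2)) (by
      rw [Metric.mem_ball, dist_self_add_left, Pi.norm_single, Real.norm_of_nonneg (by linarith)]
      linarith)
    simp only [Pi.add_apply, mul_add, Finset.sum_add_distrib, h0, zero_add] at h1
    rw [Finset.sum_eq_single k (fun l _ hl => by simp [hl]) (by simp), Pi.single_eq_same] at h1
    exact (mul_eq_zero.1 h1).resolve_right (by linarith)
  let L : (Fin m → ℝ) → ℝ := fun y => -(∑ k, c i (j.succAbove k) * y k) / c i j
  have hL : ∀ u : (Fin m → ℝ) × ℝ, ∑ l, c i l * insertCLM j u l = 0 → u.2 = L u.1 := fun u hu => by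
    rw [hsum] at hu
    rw [eq_div_iff hcj]
    linarith
  have hLan : AnalyticOnNhd ℝ L univ := fun y _ => by
    refine AnalyticAt.div ?_ analyticAt_const hcj
    refine (Finset.univ.analyticAt_fun_sum fun k _ => ?_).neg
    exact analyticAt_const.mul (analyticAt_pi_iff.1 analyticAt_id k)
  have hgL : AnalyticOnNhd ℝ (fun y => g (insertCLM j (y, L y))) univ := fun y _ =>
    (hg _ (mem_univ _)).comp (f := fun y => insertCLM j (y, L y))
      ((hLan y (mem_univ _)).insertCLM_graph j)
  have hgL0 := hgL.eqOn_zero_of_preconnected_of_eventuallyEq_zero isPreconnected_univ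
    (mem_univ y₀) <| by
      filter_upwards [Metric.ball_mem_nhds y₀ hr] with y hy
      rw [← hL (y, φ y) (hi0 y hy)]
      exact hzero y hy
  have hxu : insertCLM j (fun k => x (j.succAbove k), x j) = x := by
    rw [insertCLM_apply]
    exact Fin.insertNth_self_removeNth j x
  have := hgL0 (mem_univ fun k => x (j.succAbove k))
  rw [← hxu] at hx ⊢
  have hxj : x j = L fun k => x (j.succAbove k) := hL _ hx
  rw [hxj]
  exact this

theorem analyticOnNhd_expEval {n : ℕ} (P : MvPolynomial (Fin n ⊕ Fin n) ℝ) :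
    AnalyticOnNhd ℝ (expEval P) univ := by
  have hproj : ∀ i : Fin n, AnalyticOnNhd ℝ (fun x : Fin n → ℝ => x i) univ := fun i x _ =>
    analyticAt_pi_iff.1 analyticAt_id i
  refine AnalyticOnNhd.aeval_mvPolynomial (f := fun x => Sum.elim x fun i => Real.exp (x i))
    (fun s => ?_) P
  rcases s with i | i
  · exact hproj i
  · exact (hproj i).rexp

theorem finite_Uexps {n : ℕ} (P : MvPolynomial (Fin n ⊕ Fin n) ℝ) : (Uexps P).Finite :=
  P.support.finite_toSet.image _

/-- Under Schanuel's conjecture, if the zero set of an E-polynomial satisfying many polynomial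
relations contains an analytic hypersurface inside an open set `U`, then it contains a rational
hyperplane meeting `U`. -/
theorem SchanuelConjecture.exists_hyperplane_subset_s17 (hSch : SchanuelConjecture) {m : ℕ}
    {K : Subfield ℝ} (hK : RealAlgExt K) {Q : MvPolynomial (Fin (m + 1) ⊕ Fin (m + 1)) ℝ}
    (hQ : CoeffsIn K Q) {r : ∀ v, MvPolynomial {s : Fin (m + 1) ⊕ Fin (m + 1) // s ≠ v} K}
    (hr0 : ∀ v, r v ≠ 0) (hr : ∀ v z, MvPolynomial.eval z Q = 0 →
      MvPolynomial.aeval (fun s : {s // s ≠ v} => z s) (r v) = 0)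
    {U : Set (Fin (m + 1) → ℝ)} {j : Fin (m + 1)} {y₀ : Fin m → ℝ} {ρ : ℝ} (hρ : 0 < ρ)
    {φ : (Fin m → ℝ) → ℝ} (hφ : AnalyticOnNhd ℝ φ (Metric.ball y₀ ρ))
    (hgraph : ∀ y ∈ Metric.ball y₀ ρ,
      insertCLM j (y, φ y) ∈ U ∧ expEval Q (insertCLM j (y, φ y)) = 0) :
    ∃ d ∈ Uexps Q, ∃ e ∈ Uexps Q, d ≠ e ∧
      (∃ x ∈ U, ∑ i, ((d i : ℝ) - e i) * x i = 0) ∧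
      ∀ x, ∑ i, ((d i : ℝ) - e i) * x i = 0 → expEval Q x = 0 := by
  classical
  obtain ⟨β, hβ, hli⟩ := exists_isAlgebraic_linearIndependent m
  let s : Finset ((Fin (m + 1) → ℕ) × (Fin (m + 1) → ℕ)) :=
    ((finite_Uexps Q).toFinset ×ˢ (finite_Uexps Q).toFinset).filter fun p => p.1 ≠ p.2
  have hs : ∀ p, p ∈ s ↔ (p.1 ∈ Uexps Q ∧ p.2 ∈ Uexps Q) ∧ p.1 ≠ p.2 := fun p => by simp [s]
  let F : MvPolynomial (Fin (m + 1) ⊕ Fin (m + 1)) ℝ :=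
    ∏ v, MvPolynomial.map (algebraMap K ℝ) (MvPolynomial.rename Subtype.val (r v))
  have hF : F ≠ 0 := Finset.prod_ne_zero_iff.2 fun v _ h => hr0 v <|
    MvPolynomial.rename_injective _ Subtype.val_injective <|
      MvPolynomial.map_injective _ (algebraMap K ℝ).injective (by simpa using h)
  obtain ⟨p, hp, hp1, hp2⟩ := (analyticOnNhd_expEval Q).exists_hyperplane_subset_zeros hρ hφ
    (fun y hy => (hgraph y hy).2) s (c := fun p i => (p.1 i : ℝ) - p.2 i)
    (fun p hp h => ((hs p).1 hp).2 <| funext fun i => by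
      have := congrFun h i
      exact_mod_cast sub_eq_zero.1 this)
    (fun y hy δ hδ => by
      obtain ⟨δ', hδ', hball⟩ := Metric.isOpen_iff.1
        (Metric.isOpen_ball.inter Metric.isOpen_ball) y ⟨Metric.mem_ball_self hδ, hy⟩
      obtain ⟨z, hzβ, hzy, hzF⟩ := exists_rat_mul_eval_ne_zero
        (c := fun k => Sum.inl (j.succAbove k))
        (Sum.inl_injective.comp Fin.succAbove_right_injective) (fun k => hli.ne_zero k) hF y hδ'
      obtain ⟨hy1, hy2⟩ := hball hzy
      refine ⟨_, hy1, hy2, ?_⟩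
      set y' : Fin m → ℝ := fun k => z (Sum.inl (j.succAbove k)) with hy'
      have hx : ∀ k, insertCLM j (y', φ y') (j.succAbove k) = z (Sum.inl (j.succAbove k)) :=
        fun k => by rw [insertCLM_apply]; simp [hy']
      obtain ⟨d, e, hd, he, hde, heq⟩ := hSch.mem_WP_of_relations hK hQ hβ hli
        (fun k => by rw [hx]; exact hzβ k) (hgraph y' hy2).2 hr (z := z)
        (fun i hij => by
          obtain ⟨k, rfl⟩ := Fin.exists_succAbove_eq hij
          exact (hx k).symm)
        (fun v hv => hzF <| by
          rw [map_prod]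
          refine Finset.prod_eq_zero (Finset.mem_univ v) ?_
          rw [MvPolynomial.eval_map, ← MvPolynomial.aeval_def, MvPolynomial.aeval_rename]
          exact hv)
      refine ⟨(d, e), (hs _).2 ⟨⟨hd, he⟩, hde⟩, ?_⟩
      simp only [sub_mul, Finset.sum_sub_distrib]
      exact sub_eq_zero.2 heq)
  obtain ⟨⟨hd, he⟩, hde⟩ := (hs p).1 hp
  have hy₀ := Metric.mem_ball_self (x := y₀) hρ
  exact ⟨p.1, hd, p.2, he, hde, ⟨_, (hgraph y₀ hy₀).1, hp1 y₀ hy₀⟩, hp2⟩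

/-- Assuming Schanuel's conjecture, every `(n-1)`-dimensional irreducible component `T` of
`V = Z(E(P))` (with `Z(P)` irreducible over `𝕂`, `dim V = n-1`) either coincides with `V`,
or contains finitely many rational hyperplanes through the origin outside of which every
point of `T` has local dimension `< n-1`. -/
theorem stmt17 (hSch : SchanuelConjecture) (n : ℕ) (K : Subfield ℝ) (hK : RealAlgExt K)
    (P : MvPolynomial (Fin n ⊕ Fin n) ℝ) (hP : CoeffsIn K P)
    (hirr : IsIrredAlgSet K {z : Fin n ⊕ Fin n → ℝ | MvPolynomial.eval z P = 0})
    (V : Set (Fin n → ℝ)) (hVdef : V = {x | expEval P x = 0})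
    (hdim : dimH V = ((n - 1 : ℕ) : ℝ≥0∞))
    (T : Set (Fin n → ℝ)) (hT : IsExpComponent K T V)
    (hdimT : dimH T = ((n - 1 : ℕ) : ℝ≥0∞)) :
    T = V ∨
    ∃ (k : ℕ) (H : Fin k → Set (Fin n → ℝ)),
      (∀ j, ∃ m : Fin n → ℤ, (∃ i, m i ≠ 0) ∧
        H j = {x : Fin n → ℝ | ∑ i, (m i : ℝ) * x i = 0}) ∧
      (⋃ j, H j) ⊆ T ∧
      ∀ x ∈ T \ ⋃ j, H j, locDim T x < ((n - 1 : ℕ) : ℝ≥0∞) := by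
  subst hVdef
  by_cases hTV : T = {x | expEval P x = 0}
  · exact Or.inl hTV
  right
  obtain ⟨⟨⟨R, hR, rfl⟩, hTne, -⟩, hTsub, -⟩ := hT
  obtain ⟨x₀, hx₀P, hx₀R⟩ := not_subset.1 fun h => hTV (hTsub.antisymm h)
  cases n with
  | zero =>
    obtain ⟨x₁, hx₁⟩ := hTne
    exact absurd (Subsingleton.elim x₁ x₀ ▸ hx₁) hx₀R
  | succ m =>
  rw [Nat.add_sub_cancel] at *
  have huniv : ∀ A : Set (Fin (m + 1) → ℝ), dimH A = (m : ℝ≥0∞) → A ≠ univ := by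
    rintro A hA rfl
    rw [Real.dimH_univ_pi_fin] at hA
    exact absurd (Nat.cast_injective (R := ℝ≥0∞) hA) (Nat.succ_ne_self m)
  have hP0 : P ≠ 0 := by
    rintro rfl
    exact huniv _ hdim (eq_univ_of_forall fun x => by simp [expEval])
  set Q := P ^ 2 + R ^ 2 with hQdef
  have hQ : CoeffsIn K Q := hP.sq_add_sq hR
  have hQeval : ∀ z, MvPolynomial.eval z Q = 0 ↔
      MvPolynomial.eval z P = 0 ∧ MvPolynomial.eval z R = 0 := fun z => by
    rw [hQdef, map_add, map_pow, map_pow,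
      add_eq_zero_iff_of_nonneg (sq_nonneg _) (sq_nonneg _), sq_eq_zero_iff, sq_eq_zero_iff]
  have hTQ : {x | expEval R x = 0} = {x | expEval Q x = 0} := by
    ext x
    exact ⟨fun h => (hQeval _).2 ⟨hTsub h, h⟩, fun h => ((hQeval _).1 h).2⟩
  choose r hr0 hr using fun v =>
    exists_relation_of_isIrredAlgSet hP hR hirr hP0 hx₀P hx₀R v
  rw [hTQ] at hdimT ⊢
  let h : (Fin (m + 1) → ℕ) × (Fin (m + 1) → ℕ) → Set (Fin (m + 1) → ℝ) := fun p =>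
    {x | ∑ i, (((p.1 i : ℤ) - p.2 i : ℤ) : ℝ) * x i = 0}
  have hfin : {p | p ∈ Uexps Q ×ˢ Uexps Q ∧ p.1 ≠ p.2 ∧ h p ⊆ {x | expEval Q x = 0}}.Finite :=
    ((finite_Uexps Q).prod (finite_Uexps Q)).subset fun p hp => hp.1
  set D := hfin.toFinset with hD
  have hmemD : ∀ p, p ∈ D ↔
      p ∈ Uexps Q ×ˢ Uexps Q ∧ p.1 ≠ p.2 ∧ h p ⊆ {x | expEval Q x = 0} := fun p => by
    rw [hD, Finite.mem_toFinset]; rfl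
  refine ⟨D.card, fun i => h (D.equivFin.symm i), fun i => ⟨_, ?_, rfl⟩, ?_, ?_⟩
  · by_contra! hcon
    refine ((hmemD _).1 (D.equivFin.symm i).2).2.1 (funext fun l => ?_)
    exact_mod_cast sub_eq_zero.1 (hcon l)
  · exact iUnion_subset fun i => ((hmemD _).1 (D.equivFin.symm i).2).2.2
  · rintro x ⟨hxQ, hxH⟩
    have hclosed : IsClosed (⋃ i, h (D.equivFin.symm i)) := isClosed_iUnion_of_finite fun i =>
      isClosed_eq (by fun_prop) continuous_const
    obtain ⟨ε, hε, hball⟩ := Metric.isOpen_iff.1 hclosed.isOpen_compl x hxH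
    have hne : ∃ y ∈ Metric.ball x ε, expEval Q y ≠ 0 := by
      by_contra! hcon
      refine huniv _ hdimT (eq_univ_of_forall fun y => ?_)
      exact (analyticOnNhd_expEval Q).eqOn_zero_of_preconnected_of_eventuallyEq_zero
        isPreconnected_univ (mem_univ x)
        (Filter.mem_of_superset (Metric.ball_mem_nhds x hε) hcon) (mem_univ y)
    rcases ((analyticOnNhd_expEval Q).mono (subset_univ _)).exists_graph_subset_zeros_or
      Metric.isOpen_ball (convex_ball x ε).isPreconnected hne with
      ⟨j, y₀, ρ, φ, hρ, hφ, hgraph⟩ | hempty | hlt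
    · obtain ⟨d, hd, e, he, hde, ⟨y, hyU, hy⟩, hsub⟩ := hSch.exists_hyperplane_subset_s17 hK hQ hr0
        (fun v z hz => hr v z ((hQeval z).1 hz).1 ((hQeval z).1 hz).2) hρ hφ hgraph
      have hmem : (d, e) ∈ D := (hmemD _).2 ⟨⟨hd, he⟩, hde, fun w hw => hsub w <| by
        simpa [h] using hw⟩
      refine absurd (mem_iUnion.2 ⟨D.equivFin ⟨_, hmem⟩, ?_⟩) (hball hyU)
      simpa [h] using hy
    · exact absurd (show x ∈ {y ∈ Metric.ball x ε | expEval Q y = 0} from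
        ⟨Metric.mem_ball_self hε, hxQ⟩) (by rw [hempty]; exact notMem_empty x)
    · have hle : locDim {x | expEval Q x = 0} x ≤
          dimH {y ∈ Metric.ball x ε | expEval Q y = 0} :=
        (iInf₂_le ε hε).trans (dimH_mono fun y hy => ⟨hy.2, hy.1⟩)
      refine hle.trans_lt (lt_of_lt_of_le (ENNReal.lt_add_right (fun htop => ?_) one_ne_zero) hlt)
      rw [htop, top_add] at hlt
      exact ENNReal.natCast_ne_top m (top_le_iff.1 hlt)

end
end
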